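/- arXiv:1411.4611 — 3 statements merged into one kernel-verified Lean document; each statement's English description precedes it below -/
import Mathlib

section
/- Let W be a bi-semi-regular multiplicative unitary on a complex Hilbert space H. Then A(W) is a C*-subalgebra of B(H): it is norm-closed, closed under composition, and closed under taking adjoints. -/
/-!
Common framework: we axiomatize realizations of Hilbert-space tensor products.
A `TensorPair E F EF` realizes the Hilbert tensor product `E ⊗ F` as the Hilbert
space `EF`: it consists of a bilinear map `(a, b) ↦ a ⊗ b` whose image satisfies
the characteristic inner-product identity and has total (dense) linear span.
Operators such as the leg operators `X₁₂`, `X₂₃`, `X₁₃`, amplifications `a ⊗ b`,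
and the tensor flip `Σ` are then uniquely characterized by their matrix
coefficients against elementary tensors.
-/

noncomputable section

open scoped InnerProductSpace
open ContinuousLinearMap

/-- A realization of the Hilbert tensor product `E ⊗ F` as the Hilbert space `EF`. -/
structure TensorPair (E F EF : Type*)
    [NormedAddCommGroup E] [InnerProductSpace ℂ E]
    [NormedAddCommGroup F] [InnerProductSpace ℂ F]
    [NormedAddCommGroup EF] [InnerProductSpace ℂ EF] where
  tmul : E →ₗ[ℂ] F →ₗ[ℂ] EF
  inner_tmul : ∀ (a c : E) (b d : F), ⟪tmul a b, tmul c d⟫_ℂ = ⟪a, c⟫_ℂ * ⟪b, d⟫_ℂ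
  dense_span : Dense (Submodule.span ℂ {z : EF | ∃ a b, z = tmul a b} : Set EF)

/-- A realization of the threefold Hilbert tensor product `E ⊗ F ⊗ G` as `EFG`. -/
structure TensorTriple (E F G EFG : Type*)
    [NormedAddCommGroup E] [InnerProductSpace ℂ E]
    [NormedAddCommGroup F] [InnerProductSpace ℂ F]
    [NormedAddCommGroup G] [InnerProductSpace ℂ G]
    [NormedAddCommGroup EFG] [InnerProductSpace ℂ EFG] where
  tmul : E →ₗ[ℂ] F →ₗ[ℂ] G →ₗ[ℂ] EFG
  inner_tmul : ∀ (a a' : E) (b b' : F) (c c' : G),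
    ⟪tmul a b c, tmul a' b' c'⟫_ℂ = ⟪a, a'⟫_ℂ * ⟪b, b'⟫_ℂ * ⟪c, c'⟫_ℂ
  dense_span : Dense (Submodule.span ℂ {z : EFG | ∃ a b c, z = tmul a b c} : Set EFG)

/-- The norm-closed linear span `[S]` of a set of vectors/operators. -/
def cspan {V : Type*} [NormedAddCommGroup V] [NormedSpace ℂ V] (S : Set V) : Set V :=
  closure (Submodule.span ℂ S : Set V)

/-- The set of right-leg slices `(id ⊗ ω_{ξ,η})(X)` of an operator
`X : M₁ ⊗ K₁ → M₂ ⊗ K₂`, i.e. all operators `T : M₁ → M₂` such that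
`⟪ζ, T ζ'⟫ = ⟪ζ ⊗ ξ, X (ζ' ⊗ η)⟫` for some `ξ ∈ K₂`, `η ∈ K₁`. -/
def slicesR {M₁ K₁ M₂ K₂ Ha Hb : Type*}
    [NormedAddCommGroup M₁] [InnerProductSpace ℂ M₁]
    [NormedAddCommGroup K₁] [InnerProductSpace ℂ K₁]
    [NormedAddCommGroup M₂] [InnerProductSpace ℂ M₂]
    [NormedAddCommGroup K₂] [InnerProductSpace ℂ K₂]
    [NormedAddCommGroup Ha] [InnerProductSpace ℂ Ha]
    [NormedAddCommGroup Hb] [InnerProductSpace ℂ Hb]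
    (ta : TensorPair M₁ K₁ Ha) (tb : TensorPair M₂ K₂ Hb)
    (X : Ha →L[ℂ] Hb) : Set (M₁ →L[ℂ] M₂) :=
  {T | ∃ (ξ : K₂) (η : K₁), ∀ (ζ : M₂) (ζ' : M₁),
    ⟪ζ, T ζ'⟫_ℂ = ⟪tb.tmul ζ ξ, X (ta.tmul ζ' η)⟫_ℂ}

/-- The set of left-leg slices `(ω_{ξ,η} ⊗ id)(X)` of an operator
`X : K₁ ⊗ M₁ → K₂ ⊗ M₂`, i.e. all operators `T : M₁ → M₂` such that
`⟪ζ, T ζ'⟫ = ⟪ξ ⊗ ζ, X (η ⊗ ζ')⟫` for some `ξ ∈ K₂`, `η ∈ K₁`. -/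
def slicesL {M₁ K₁ M₂ K₂ Ha Hb : Type*}
    [NormedAddCommGroup M₁] [InnerProductSpace ℂ M₁]
    [NormedAddCommGroup K₁] [InnerProductSpace ℂ K₁]
    [NormedAddCommGroup M₂] [InnerProductSpace ℂ M₂]
    [NormedAddCommGroup K₂] [InnerProductSpace ℂ K₂]
    [NormedAddCommGroup Ha] [InnerProductSpace ℂ Ha]
    [NormedAddCommGroup Hb] [InnerProductSpace ℂ Hb]
    (ta : TensorPair K₁ M₁ Ha) (tb : TensorPair K₂ M₂ Hb)
    (X : Ha →L[ℂ] Hb) : Set (M₁ →L[ℂ] M₂) :=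
  {T | ∃ (ξ : K₂) (η : K₁), ∀ (ζ : M₂) (ζ' : M₁),
    ⟪ζ, T ζ'⟫_ℂ = ⟪tb.tmul ξ ζ, X (ta.tmul η ζ')⟫_ℂ}

/-- `Â(X) := [(id ⊗ ω_{ξ,η})(X) : ξ, η ∈ H] ⊆ B(H)` for `X ∈ B(H ⊗ H)`. -/
def hatA {H H2 : Type*}
    [NormedAddCommGroup H] [InnerProductSpace ℂ H]
    [NormedAddCommGroup H2] [InnerProductSpace ℂ H2]
    (t2 : TensorPair H H H2) (X : H2 →L[ℂ] H2) : Set (H →L[ℂ] H) :=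
  cspan (slicesR t2 t2 X)

/-- `A(X) := [(ω_{ξ,η} ⊗ id)(X) : ξ, η ∈ H] ⊆ B(H)` for `X ∈ B(H ⊗ H)`. -/
def legA {H H2 : Type*}
    [NormedAddCommGroup H] [InnerProductSpace ℂ H]
    [NormedAddCommGroup H2] [InnerProductSpace ℂ H2]
    (t2 : TensorPair H H H2) (X : H2 →L[ℂ] H2) : Set (H →L[ℂ] H) :=
  cspan (slicesL t2 t2 X)

/-- `T` is the tensor-product operator `a ⊗ b : E ⊗ F → E' ⊗ F'`, characterized by its
matrix coefficients against elementary tensors.  In particular `IsTensorOp ta tb a 1 T`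
says that `T = a ⊗ 1`, and `IsTensorOp ta tb 1 b T` that `T = 1 ⊗ b`. -/
def IsTensorOp {E F EF E' F' EF' : Type*}
    [NormedAddCommGroup E] [InnerProductSpace ℂ E]
    [NormedAddCommGroup F] [InnerProductSpace ℂ F]
    [NormedAddCommGroup EF] [InnerProductSpace ℂ EF]
    [NormedAddCommGroup E'] [InnerProductSpace ℂ E']
    [NormedAddCommGroup F'] [InnerProductSpace ℂ F']
    [NormedAddCommGroup EF'] [InnerProductSpace ℂ EF']
    (ta : TensorPair E F EF) (tb : TensorPair E' F' EF')
    (a : E →L[ℂ] E') (b : F →L[ℂ] F') (T : EF →L[ℂ] EF') : Prop :=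
  ∀ (ζ : E') (ξ : F') (ζ' : E) (η : F),
    ⟪tb.tmul ζ ξ, T (ta.tmul ζ' η)⟫_ℂ = ⟪ζ, a ζ'⟫_ℂ * ⟪ξ, b η⟫_ℂ

/-- `A ⊗min B := [(a ⊗ 1)(1 ⊗ b) : a ∈ A, b ∈ B] = [a ⊗ b : a ∈ A, b ∈ B]`. -/
def minTensor {E F EF : Type*}
    [NormedAddCommGroup E] [InnerProductSpace ℂ E]
    [NormedAddCommGroup F] [InnerProductSpace ℂ F]
    [NormedAddCommGroup EF] [InnerProductSpace ℂ EF]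
    (t : TensorPair E F EF)
    (A : Set (E →L[ℂ] E)) (B : Set (F →L[ℂ] F)) : Set (EF →L[ℂ] EF) :=
  cspan {T | ∃ a ∈ A, ∃ b ∈ B, IsTensorOp t t a b T}

/-- `Y = X₁₂ = X ⊗ 1` on `E ⊗ F ⊗ G`, for `X ∈ B(E ⊗ F)`. -/
def IsLeg12 {E F G EF EFG : Type*}
    [NormedAddCommGroup E] [InnerProductSpace ℂ E]
    [NormedAddCommGroup F] [InnerProductSpace ℂ F]
    [NormedAddCommGroup G] [InnerProductSpace ℂ G]
    [NormedAddCommGroup EF] [InnerProductSpace ℂ EF]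
    [NormedAddCommGroup EFG] [InnerProductSpace ℂ EFG]
    (t2 : TensorPair E F EF) (t3 : TensorTriple E F G EFG)
    (X : EF →L[ℂ] EF) (Y : EFG →L[ℂ] EFG) : Prop :=
  ∀ (a a' : E) (b b' : F) (c c' : G),
    ⟪t3.tmul a b c, Y (t3.tmul a' b' c')⟫_ℂ
      = ⟪t2.tmul a b, X (t2.tmul a' b')⟫_ℂ * ⟪c, c'⟫_ℂ

/-- `Y = X₂₃ = 1 ⊗ X` on `E ⊗ F ⊗ G`, for `X ∈ B(F ⊗ G)`. -/
def IsLeg23 {E F G FG EFG : Type*}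
    [NormedAddCommGroup E] [InnerProductSpace ℂ E]
    [NormedAddCommGroup F] [InnerProductSpace ℂ F]
    [NormedAddCommGroup G] [InnerProductSpace ℂ G]
    [NormedAddCommGroup FG] [InnerProductSpace ℂ FG]
    [NormedAddCommGroup EFG] [InnerProductSpace ℂ EFG]
    (t2 : TensorPair F G FG) (t3 : TensorTriple E F G EFG)
    (X : FG →L[ℂ] FG) (Y : EFG →L[ℂ] EFG) : Prop :=
  ∀ (a a' : E) (b b' : F) (c c' : G),
    ⟪t3.tmul a b c, Y (t3.tmul a' b' c')⟫_ℂ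
      = ⟪t2.tmul b c, X (t2.tmul b' c')⟫_ℂ * ⟪a, a'⟫_ℂ

/-- `Y = X₁₃ = Σ₁₂X₂₃Σ₁₂` on `E ⊗ F ⊗ G`, for `X ∈ B(E ⊗ G)`: `X` acting on the
first and third legs. -/
def IsLeg13 {E F G EG EFG : Type*}
    [NormedAddCommGroup E] [InnerProductSpace ℂ E]
    [NormedAddCommGroup F] [InnerProductSpace ℂ F]
    [NormedAddCommGroup G] [InnerProductSpace ℂ G]
    [NormedAddCommGroup EG] [InnerProductSpace ℂ EG]
    [NormedAddCommGroup EFG] [InnerProductSpace ℂ EFG]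
    (t2 : TensorPair E G EG) (t3 : TensorTriple E F G EFG)
    (X : EG →L[ℂ] EG) (Y : EFG →L[ℂ] EFG) : Prop :=
  ∀ (a a' : E) (b b' : F) (c c' : G),
    ⟪t3.tmul a b c, Y (t3.tmul a' b' c')⟫_ℂ
      = ⟪t2.tmul a c, X (t2.tmul a' c')⟫_ℂ * ⟪b, b'⟫_ℂ

section Aux

set_option linter.unusedSectionVars false

variable {H H2 H3 K K' X : Type*}
    [NormedAddCommGroup H] [InnerProductSpace ℂ H] [CompleteSpace H]
    [NormedAddCommGroup H2] [InnerProductSpace ℂ H2] [CompleteSpace H2]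
    [NormedAddCommGroup H3] [InnerProductSpace ℂ H3] [CompleteSpace H3]
    [NormedAddCommGroup K] [InnerProductSpace ℂ K] [CompleteSpace K]
    [NormedAddCommGroup K'] [InnerProductSpace ℂ K'] [CompleteSpace K']
    [NormedAddCommGroup X] [InnerProductSpace ℂ X] [CompleteSpace X]

/-- Column module: closed span of the operators `J ξ ∘ s`, `s ∈ S`. -/
def col (J : H →L[ℂ] K →L[ℂ] K') (S : Set (X →L[ℂ] K)) : Submodule ℂ (X →L[ℂ] K') :=
  (Submodule.span ℂ {x | ∃ ξ, ∃ s ∈ S, x = (J ξ) ∘L s}).topologicalClosure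

lemma closedSpan_map {V V' : Type*} [NormedAddCommGroup V] [NormedSpace ℂ V]
    [NormedAddCommGroup V'] [NormedSpace ℂ V'] (S : Set V) (T : V →L[ℂ] V')
    (P : Submodule ℂ V') (hP : IsClosed (P : Set V')) (h : ∀ s ∈ S, T s ∈ P) :
    ∀ x ∈ (Submodule.span ℂ S).topologicalClosure, T x ∈ P := by
  have h1 : (Submodule.span ℂ S).topologicalClosure ≤ P.comap T.toLinearMap := by
    apply Submodule.topologicalClosure_minimal
    · rw [Submodule.span_le]
      intro s hs
      exact h s hs
    · exact hP.preimage T.continuous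
  intro x hx
  exact h1 hx

lemma col_map {V : Type*} [NormedAddCommGroup V] [NormedSpace ℂ V]
    (J : H →L[ℂ] K →L[ℂ] K') (S : Set (X →L[ℂ] K)) (T : (X →L[ℂ] K') →L[ℂ] V)
    (P : Submodule ℂ V) (hP : IsClosed (P : Set V))
    (h : ∀ ξ, ∀ s ∈ S, T ((J ξ) ∘L s) ∈ P) : ∀ x ∈ col J S, T x ∈ P := by
  apply closedSpan_map _ T P hP
  rintro s ⟨ξ, s, hs, rfl⟩
  exact h ξ s hs

lemma col_comp {Y : Type*} [NormedAddCommGroup Y] [InnerProductSpace ℂ Y]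
    (J : H →L[ℂ] K →L[ℂ] K') (S : Set (X →L[ℂ] K)) (T : K' →L[ℂ] Y)
    (P : Submodule ℂ (X →L[ℂ] Y)) (hP : IsClosed (P : Set (X →L[ℂ] Y)))
    (h : ∀ ξ, ∀ s ∈ S, T ∘L ((J ξ) ∘L s) ∈ P) : ∀ x ∈ col J S, T ∘L x ∈ P :=
  col_map J S (compL ℂ X K' Y T) P hP h

lemma mem_col (J : H →L[ℂ] K →L[ℂ] K') (S : Set (X →L[ℂ] K)) (ξ : H) (s : X →L[ℂ] K)
    (hs : s ∈ S) : (J ξ) ∘L s ∈ col J S :=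
  Submodule.le_topologicalClosure _ (Submodule.subset_span ⟨ξ, s, hs, rfl⟩)

lemma col_closed (J : H →L[ℂ] K →L[ℂ] K') (S : Set (X →L[ℂ] K)) :
    IsClosed (col J S : Set (X →L[ℂ] K')) := Submodule.isClosed_topologicalClosure _

lemma col_mono (J : H →L[ℂ] K →L[ℂ] K') {S S' : Set (X →L[ℂ] K)} (h : S ⊆ S') :
    col J S ≤ col J S' := by
  apply Submodule.topologicalClosure_mono
  apply Submodule.span_mono
  rintro x ⟨ξ, s, hs, rfl⟩
  exact ⟨ξ, s, h hs, rfl⟩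

/-- The projection `P ⊗ 1` onto the part over a finite-dimensional space. -/
lemma exists_fin_proj (J : H →L[ℂ] K →L[ℂ] K')
    (hJ : ∀ x y, adjoint (J x) ∘L J y = ⟪x, y⟫_ℂ • (1 : K →L[ℂ] K))
    (F : Submodule ℂ H) [FiniteDimensional ℂ F] :
    ∃ Q : K' →L[ℂ] K', ‖Q‖ ≤ 1 ∧ (∀ ξ ∈ F, Q ∘L J ξ = J ξ) ∧
      ∃ (n : ℕ) (e : Fin n → H), Q = ∑ i, J (e i) ∘L adjoint (J (e i)) := by
  let b := stdOrthonormalBasis ℂ F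
  set e : Fin (Module.finrank ℂ F) → H := fun i => (b i : H) with he
  have hon : ∀ i j, ⟪e i, e j⟫_ℂ = if i = j then 1 else 0 := by
    intro i j
    have := (orthonormal_iff_ite.mp b.orthonormal) i j
    simpa using this
  set Q : K' →L[ℂ] K' := ∑ i, J (e i) ∘L adjoint (J (e i)) with hQ
  have hQJ : ∀ ξ, Q ∘L J ξ = ∑ i, ⟪e i, ξ⟫_ℂ • J (e i) := by
    intro ξ
    rw [hQ, ContinuousLinearMap.finsetSum_comp]
    apply Finset.sum_congr rfl
    intro i _
    rw [ContinuousLinearMap.comp_assoc, hJ, ContinuousLinearMap.comp_smul]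
    rfl
  have hfix : ∀ ξ ∈ F, Q ∘L J ξ = J ξ := by
    intro ξ hξ
    rw [hQJ]
    have h1 := b.sum_repr' ⟨ξ, hξ⟩
    have h2 : ξ = ∑ i, ⟪e i, ξ⟫_ℂ • e i := by
      have := congrArg (Subtype.val) h1
      simp at this
      exact this.symm
    conv_rhs => rw [h2]
    simp
  have hsa : adjoint Q = Q := by
    rw [hQ, map_sum]
    apply Finset.sum_congr rfl
    intro i _
    rw [ContinuousLinearMap.adjoint_comp, ContinuousLinearMap.adjoint_adjoint]
  have hid : Q ∘L Q = Q := by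
    conv_lhs => rw [hQ, ContinuousLinearMap.comp_finsetSum]
    conv_rhs => rw [hQ]
    apply Finset.sum_congr rfl
    intro i _
    rw [← ContinuousLinearMap.comp_assoc, ← hQ, hfix _ (b i).2]
  refine ⟨Q, ?_, hfix, _, e, rfl⟩
  have h3 : ‖Q‖ * ‖Q‖ = ‖Q‖ := by
    have := ContinuousLinearMap.norm_adjoint_comp_self Q
    rw [hsa, hid] at this
    exact this.symm
  by_contra hc
  push Not at hc
  nlinarith

lemma mem_col_of_slices (J : H →L[ℂ] K →L[ℂ] K')
    (hJ : ∀ x y, adjoint (J x) ∘L J y = ⟪x, y⟫_ℂ • (1 : K →L[ℂ] K))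
    (S : Set (X →L[ℂ] K)) (x : X →L[ℂ] K') (hx : x ∈ col J (Set.univ : Set (X →L[ℂ] K)))
    (hs : ∀ ξ, adjoint (J ξ) ∘L x ∈ S) : x ∈ col J S := by
  have hcl := col_closed J S
  rw [← SetLike.mem_coe, ← hcl.closure_eq, Metric.mem_closure_iff]
  intro ε hε
  have hx' : x ∈ closure (Submodule.span ℂ {x | ∃ ξ, ∃ s ∈ (Set.univ : Set (X →L[ℂ] K)),
    x = (J ξ) ∘L s} : Set (X →L[ℂ] K')) := hx
  obtain ⟨y, hy, hxy⟩ := Metric.mem_closure_iff.mp hx' (ε / 2) (by positivity)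
  have hF : ∃ F : Submodule ℂ H, FiniteDimensional ℂ F ∧
      ∀ Q : K' →L[ℂ] K', (∀ ξ ∈ F, Q ∘L J ξ = J ξ) → Q ∘L y = y := by
    clear hxy
    refine Submodule.span_induction ?_ ?_ ?_ ?_ hy
    · rintro _ ⟨ξ, s, -, rfl⟩
      refine ⟨ℂ ∙ ξ, inferInstance, fun Q hQ => ?_⟩
      rw [← ContinuousLinearMap.comp_assoc, hQ ξ (Submodule.mem_span_singleton_self ξ)]
    · exact ⟨⊥, inferInstance, fun Q _ => by simp⟩
    · rintro u v - - ⟨F, hF, h1⟩ ⟨G, hG, h2⟩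
      refine ⟨F ⊔ G, inferInstance, fun Q hQ => ?_⟩
      rw [ContinuousLinearMap.comp_add, h1 Q (fun ξ h => hQ ξ (Submodule.mem_sup_left h)),
        h2 Q (fun ξ h => hQ ξ (Submodule.mem_sup_right h))]
    · rintro c u - ⟨F, hF, h1⟩
      exact ⟨F, hF, fun Q hQ => by rw [ContinuousLinearMap.comp_smul, h1 Q hQ]⟩
  obtain ⟨F, hFd, hF⟩ := hF
  obtain ⟨Q, hQ1, hQ2, n, e, hQ3⟩ := exists_fin_proj J hJ F
  refine ⟨Q ∘L x, ?_, ?_⟩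
  · rw [hQ3, ContinuousLinearMap.finsetSum_comp]
    apply Submodule.sum_mem
    intro i _
    rw [ContinuousLinearMap.comp_assoc]
    exact mem_col J S _ _ (hs _)
  · have h1 : dist y (Q ∘L x) ≤ dist x y := by
      rw [dist_eq_norm, dist_eq_norm, norm_sub_rev x y]
      have : y - Q ∘L x = Q ∘L (y - x) := by
        rw [ContinuousLinearMap.comp_sub, hF Q hQ2]
      rw [this]
      calc _ ≤ ‖Q‖ * ‖y - x‖ := ContinuousLinearMap.opNorm_comp_le _ _
        _ ≤ 1 * ‖y - x‖ := by gcongr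
        _ = _ := one_mul _
    calc dist x (Q ∘L x) ≤ dist x y + dist y (Q ∘L x) := dist_triangle _ _ _
      _ < ε := by linarith


set_option linter.unusedSectionVars false

lemma ext_dense {Y Z : Type*} [NormedAddCommGroup Y] [NormedSpace ℂ Y]
    [NormedAddCommGroup Z] [NormedSpace ℂ Z] {s : Set Y}
    (hs : Dense (Submodule.span ℂ s : Set Y)) (f g : Y →L[ℂ] Z) (h : ∀ y ∈ s, f y = g y) :
    f = g :=
  ContinuousLinearMap.ext_on hs h

lemma eq_of_inner_dense {s : Set K} (hs : Dense (Submodule.span ℂ s : Set K)) (v w : K)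
    (h : ∀ y ∈ s, ⟪y, v⟫_ℂ = ⟪y, w⟫_ℂ) : v = w := by
  have h1 : innerSL ℂ v = innerSL ℂ w := by
    apply ext_dense hs
    intro y hy
    simp only [innerSL_apply_apply]
    rw [← inner_conj_symm, h y hy, inner_conj_symm]
  apply ext_inner_right ℂ
  intro y
  have := congrArg (fun f => f y) h1
  simpa using this

namespace TensorPair

variable (t2 : TensorPair H H H2)

lemma norm_tmul_eq (a b : H) : ‖t2.tmul a b‖ = ‖a‖ * ‖b‖ := by
  have h := t2.inner_tmul a a b b
  rw [inner_self_eq_norm_sq_to_K, inner_self_eq_norm_sq_to_K, inner_self_eq_norm_sq_to_K] at h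
  have h2 : ‖t2.tmul a b‖ ^ 2 = (‖a‖ * ‖b‖) ^ 2 := by
    rw [mul_pow]
    exact_mod_cast h
  exact (pow_left_inj₀ (norm_nonneg _) (by positivity) two_ne_zero).mp h2

/-- Left creation operators. -/
def L : H →L[ℂ] H →L[ℂ] H2 :=
  t2.tmul.mkContinuous₂ 1 (fun a b => by rw [t2.norm_tmul_eq, one_mul])

lemma L_apply (a b : H) : t2.L a b = t2.tmul a b := rfl

lemma ext_of {Y : Type*} [NormedAddCommGroup Y] [NormedSpace ℂ Y]
    (f g : H2 →L[ℂ] Y) (h : ∀ a b, f (t2.tmul a b) = g (t2.tmul a b)) : f = g := by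
  apply ext_dense t2.dense_span
  rintro _ ⟨a, b, rfl⟩
  exact h a b

/-- algebraic tensor product into `H2` -/
def e : TensorProduct ℂ H H →ₗ[ℂ] H2 := TensorProduct.lift t2.tmul

lemma denseRange_e : DenseRange t2.e := by
  apply t2.dense_span.mono
  have : Submodule.span ℂ {z : H2 | ∃ a b, z = t2.tmul a b} ≤ LinearMap.range t2.e := by
    rw [Submodule.span_le]
    rintro _ ⟨a, b, rfl⟩
    exact ⟨a ⊗ₜ b, by simp [e]⟩
  exact this

lemma exists_ext (T : H →ₗ[ℂ] H →ₗ[ℂ] H →ₗ[ℂ] H3)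
    (hT : ∀ a b c a' b' c', ⟪T a b c, T a' b' c'⟫_ℂ = ⟪a, a'⟫_ℂ * ⟪b, b'⟫_ℂ * ⟪c, c'⟫_ℂ) :
    ∃ G : H →L[ℂ] H2 →L[ℂ] H3, (∀ a b c, G c (t2.tmul a b) = T a b c) ∧
      ∀ x y, adjoint (G x) ∘L G y = ⟪x, y⟫_ℂ • (1 : H2 →L[ℂ] H2) := by
  let f : TensorProduct ℂ H H →ₗ[ℂ] H →ₗ[ℂ] H3 := TensorProduct.lift T
  have hf : ∀ x y c c', ⟪f x c, f y c'⟫_ℂ = ⟪t2.e x, t2.e y⟫_ℂ * ⟪c, c'⟫_ℂ := by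
    intro x y c c'
    induction x using TensorProduct.induction_on with
    | zero => simp
    | add x x' h h' => simp only [map_add, LinearMap.add_apply, inner_add_left, h, h', add_mul]
    | tmul a b =>
      induction y using TensorProduct.induction_on with
      | zero => simp
      | add x x' h h' => simp only [map_add, LinearMap.add_apply, inner_add_right, h, h', add_mul]
      | tmul a' b' => simp [f, e, hT, t2.inner_tmul]
  have hn : ∀ x c, ‖f x c‖ = ‖t2.e x‖ * ‖c‖ := by
    intro x c
    have h := hf x x c c
    rw [inner_self_eq_norm_sq_to_K, inner_self_eq_norm_sq_to_K, inner_self_eq_norm_sq_to_K] at h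
    have h2 : ‖f x c‖ ^ 2 = (‖t2.e x‖ * ‖c‖) ^ 2 := by
      rw [mul_pow]
      exact_mod_cast h
    exact (pow_left_inj₀ (norm_nonneg _) (by positivity) two_ne_zero).mp h2
  let g : TensorProduct ℂ H H →ₗ[ℂ] (H →L[ℂ] H3) :=
    { toFun := fun x => (f x).mkContinuous ‖t2.e x‖ (fun c => (hn x c).le)
      map_add' := by intro x y; ext c; simp
      map_smul' := by intro r x; ext c; simp }
  have hg : ∀ x, ‖g x‖ ≤ 1 * ‖t2.e x‖ := by
    intro x
    rw [one_mul]
    exact LinearMap.mkContinuous_norm_le _ (norm_nonneg _) (fun c => (hn x c).le)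
  have key : ∀ x, g.extendOfNorm t2.e (t2.e x) = g x :=
    LinearMap.extendOfNorm_eq t2.denseRange_e ⟨1, hg⟩
  have key2 : ∀ a b c, (g.extendOfNorm t2.e).flip c (t2.tmul a b) = T a b c := by
    intro a b c
    have := key (a ⊗ₜ b)
    have he : t2.e (a ⊗ₜ b) = t2.tmul a b := by simp [e]
    rw [he] at this
    rw [ContinuousLinearMap.flip_apply, this]
    simp [g, f]
  refine ⟨(g.extendOfNorm t2.e).flip, key2, ?_⟩
  intro x y
  apply t2.ext_of
  intro a b
  apply eq_of_inner_dense t2.dense_span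
  rintro _ ⟨a', b', rfl⟩
  simp only [ContinuousLinearMap.comp_apply, ContinuousLinearMap.adjoint_inner_right, key2, hT,
    _root_.smul_apply, one_apply_eq_self, inner_smul_right, t2.inner_tmul]
  ring

/-- algebraic amplification -/
def alg (c : H →L[ℂ] H) : TensorProduct ℂ H H →ₗ[ℂ] TensorProduct ℂ H H :=
  TensorProduct.map c.toLinearMap LinearMap.id

lemma inner_alg (c : H →L[ℂ] H) (x y : TensorProduct ℂ H H) :
    ⟪t2.e (alg c x), t2.e y⟫_ℂ = ⟪t2.e x, t2.e (alg (adjoint c) y)⟫_ℂ := by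
  induction x using TensorProduct.induction_on with
  | zero => simp
  | add x x' h h' => simp only [map_add, inner_add_left, h, h']
  | tmul a b =>
    induction y using TensorProduct.induction_on with
    | zero => simp
    | add x x' h h' => simp only [map_add, inner_add_right, h, h']
    | tmul a' b' => simp [e, alg, t2.inner_tmul, ContinuousLinearMap.adjoint_inner_right]

lemma alg_comp (c d : H →L[ℂ] H) (x : TensorProduct ℂ H H) :
    alg c (alg d x) = alg (c ∘L d) x := by
  induction x using TensorProduct.induction_on with
  | zero => simp
  | add x x' h h' => simp only [map_add, h, h']
  | tmul a b => simp [alg]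

lemma alg_sub_id (r : ℂ) (d : H →L[ℂ] H) (x : TensorProduct ℂ H H) :
    alg (r • (1 : H →L[ℂ] H) - d) x = r • x - alg d x := by
  induction x using TensorProduct.induction_on with
  | zero => simp
  | add x x' h h' => simp only [map_add, h, h', smul_add]; abel
  | tmul a b => simp [alg, TensorProduct.sub_tmul, TensorProduct.smul_tmul']

lemma norm_alg_le (c : H →L[ℂ] H) (x : TensorProduct ℂ H H) :
    ‖t2.e (alg c x)‖ ≤ ‖c‖ * ‖t2.e x‖ := by
  have h1 : star c * c ≤ algebraMap ℝ (H →L[ℂ] H) (‖c‖ ^ 2) :=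
    CStarAlgebra.star_mul_le_algebraMap_norm_sq
  obtain ⟨s, hs⟩ := CStarAlgebra.nonneg_iff_eq_star_mul_self.mp (sub_nonneg.mpr h1)
  have h2 : adjoint s ∘L s = ((‖c‖ ^ 2 : ℝ) : ℂ) • (1 : H →L[ℂ] H) - adjoint c ∘L c := by
    have h3 : algebraMap ℝ (H →L[ℂ] H) (‖c‖ ^ 2) = ((‖c‖ ^ 2 : ℝ) : ℂ) • (1 : H →L[ℂ] H) := by
      rw [Algebra.algebraMap_eq_smul_one]
      rfl
    rw [← h3]
    exact hs.symm
  have h4 : ⟪t2.e (alg s x), t2.e (alg s x)⟫_ℂ =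
      ((‖c‖ ^ 2 : ℝ) : ℂ) * ⟪t2.e x, t2.e x⟫_ℂ - ⟪t2.e (alg c x), t2.e (alg c x)⟫_ℂ := by
    rw [inner_alg, alg_comp, h2, alg_sub_id, map_sub, inner_sub_right, map_smul, inner_smul_right,
      inner_alg, alg_comp]
  rw [inner_self_eq_norm_sq_to_K, inner_self_eq_norm_sq_to_K, inner_self_eq_norm_sq_to_K] at h4
  have h5 : ‖t2.e (alg s x)‖ ^ 2 = ‖c‖ ^ 2 * ‖t2.e x‖ ^ 2 - ‖t2.e (alg c x)‖ ^ 2 := by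
    apply Complex.ofReal_injective
    push_cast
    push_cast at h4
    exact h4
  apply (pow_le_pow_iff_left₀ (norm_nonneg _) (by positivity) two_ne_zero).mp
  rw [mul_pow]
  nlinarith [sq_nonneg ‖t2.e (alg s x)‖]

lemma exists_amp : ∃ G : (H →L[ℂ] H) →L[ℂ] (H2 →L[ℂ] H2),
    (∀ c a b, G c (t2.tmul a b) = t2.tmul (c a) b) ∧ ∀ c, ‖G c‖ ≤ ‖c‖ := by
  have hb : ∀ c : H →L[ℂ] H, ∀ x, ‖(t2.e ∘ₗ alg c) x‖ ≤ ‖c‖ * ‖t2.e x‖ :=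
    fun c x => t2.norm_alg_le c x
  have key : ∀ c a b, (t2.e ∘ₗ alg c).extendOfNorm t2.e (t2.tmul a b) = t2.tmul (c a) b := by
    intro c a b
    have h := LinearMap.extendOfNorm_eq t2.denseRange_e ⟨_, hb c⟩ (a ⊗ₜ b)
    have he : t2.e (a ⊗ₜ b) = t2.tmul a b := by simp [e]
    rw [he] at h
    rw [h]
    simp [e, alg]
  have hn : ∀ c, ‖(t2.e ∘ₗ alg c).extendOfNorm t2.e‖ ≤ ‖c‖ := fun c =>
    LinearMap.opNorm_extendOfNorm_le t2.denseRange_e (norm_nonneg _) (hb c)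
  let G : (H →L[ℂ] H) →ₗ[ℂ] (H2 →L[ℂ] H2) :=
    { toFun := fun c => (t2.e ∘ₗ alg c).extendOfNorm t2.e
      map_add' := by intro c d; apply t2.ext_of; intro a b; simp [key]
      map_smul' := by intro c d; apply t2.ext_of; intro a b; simp [key] }
  refine ⟨G.mkContinuous 1 (fun c => by rw [one_mul]; exact hn c), ?_, ?_⟩
  · intro c a b
    exact key c a b
  · intro c
    exact hn c

end TensorPair

/-- Generic intertwining of legs. -/
lemma leg_intertwine (t2 : TensorPair H H H2) (G : H →L[ℂ] H2 →L[ℂ] H3)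
    (hG : ∀ x y, adjoint (G x) ∘L G y = ⟪x, y⟫_ℂ • (1 : H2 →L[ℂ] H2))
    (hd : Dense (Submodule.span ℂ {z : H3 | ∃ x a b, z = G x (t2.tmul a b)} : Set H3))
    (W : H2 →L[ℂ] H2) (Y : H3 →L[ℂ] H3)
    (h : ∀ x y a b c d, ⟪G x (t2.tmul a b), Y (G y (t2.tmul c d))⟫_ℂ =
      ⟪t2.tmul a b, W (t2.tmul c d)⟫_ℂ * ⟪x, y⟫_ℂ) (y : H) : Y ∘L G y = G y ∘L W := by
  apply t2.ext_of
  intro c d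
  apply eq_of_inner_dense hd
  rintro _ ⟨x, a, b, rfl⟩
  rw [ContinuousLinearMap.comp_apply, h, ContinuousLinearMap.comp_apply,
    ← ContinuousLinearMap.adjoint_inner_right, ← ContinuousLinearMap.comp_apply, hG]
  simp [inner_smul_right, mul_comm]

lemma leg_intertwine' (t2 : TensorPair H H H2) (G : H →L[ℂ] H2 →L[ℂ] H3)
    (hG : ∀ x y, adjoint (G x) ∘L G y = ⟪x, y⟫_ℂ • (1 : H2 →L[ℂ] H2))
    (hd : Dense (Submodule.span ℂ {z : H3 | ∃ x a b, z = G x (t2.tmul a b)} : Set H3))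
    (W : H2 →L[ℂ] H2) (Y : H3 →L[ℂ] H3)
    (h : ∀ x y a b c d, ⟪G x (t2.tmul a b), Y (G y (t2.tmul c d))⟫_ℂ =
      ⟪t2.tmul a b, W (t2.tmul c d)⟫_ℂ * ⟪x, y⟫_ℂ) (y : H) :
    adjoint Y ∘L G y = G y ∘L adjoint W := by
  apply leg_intertwine t2 G hG hd
  intro x y a b c d
  rw [ContinuousLinearMap.adjoint_inner_right, ContinuousLinearMap.adjoint_inner_right,
    ← inner_conj_symm, h, map_mul, inner_conj_symm, inner_conj_symm]

lemma leg_unitary (t2 : TensorPair H H H2) (G : H →L[ℂ] H2 →L[ℂ] H3)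
    (hd : Dense (Submodule.span ℂ {z : H3 | ∃ x a b, z = G x (t2.tmul a b)} : Set H3))
    (W W' : H2 →L[ℂ] H2) (Y Y' : H3 →L[ℂ] H3)
    (h : ∀ y, Y ∘L G y = G y ∘L W) (h' : ∀ y, Y' ∘L G y = G y ∘L W')
    (hW : W' ∘L W = 1) : Y' ∘L Y = 1 := by
  apply ext_dense hd
  rintro _ ⟨x, a, b, rfl⟩
  have h1 : (Y' ∘L Y) ∘L G x = G x := by
    rw [ContinuousLinearMap.comp_assoc, h, ← ContinuousLinearMap.comp_assoc, h',
      ContinuousLinearMap.comp_assoc, hW]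
    rfl
  exact congrArg (fun f => f (t2.tmul a b)) h1

open scoped Topology

/-- Sandwich map `c ↦ T c S`. -/
def sand {Y : Type*} [NormedAddCommGroup Y] [InnerProductSpace ℂ Y]
    (T : K' →L[ℂ] Y) (S : X →L[ℂ] K) : (K →L[ℂ] K') →L[ℂ] (X →L[ℂ] Y) :=
  (compL ℂ X K' Y T) ∘L ((compL ℂ X K K').flip S)

lemma sand_apply {Y : Type*} [NormedAddCommGroup Y] [InnerProductSpace ℂ Y]
    (T : K' →L[ℂ] Y) (S : X →L[ℂ] K) (c : K →L[ℂ] K') : sand T S c = T ∘L (c ∘L S) := rfl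

lemma closedSpan_adj_map {V' : Type*} [NormedAddCommGroup V'] [NormedSpace ℂ V']
    (S : Set (K →L[ℂ] K')) (F : (K' →L[ℂ] K) →L[ℂ] V')
    (P : Submodule ℂ V') (hP : IsClosed (P : Set V')) (h : ∀ s ∈ S, F (adjoint s) ∈ P) :
    ∀ x ∈ (Submodule.span ℂ S).topologicalClosure, F (adjoint x) ∈ P := by
  let Q : Submodule ℂ (K →L[ℂ] K') :=
    { carrier := {x | F (adjoint x) ∈ P}
      add_mem' := by
        intro a b ha hb
        simp only [Set.mem_ofPred_eq, map_add] at *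
        exact P.add_mem ha hb
      zero_mem' := by simp
      smul_mem' := by
        intro c a ha
        simp only [Set.mem_ofPred_eq, map_smulₛₗ, RingHom.id_apply] at *
        exact P.smul_mem _ ha }
  have h1 : (Submodule.span ℂ S).topologicalClosure ≤ Q := by
    apply Submodule.topologicalClosure_minimal
    · rw [Submodule.span_le]
      intro s hs
      exact h s hs
    · exact hP.preimage (F.continuous.comp (LinearIsometryEquiv.continuous adjoint))
  intro x hx
  exact h1 hx

/-- Abstract data attached to a multiplicative unitary. -/
structure Sys (H H2 H3 : Type*)
    [NormedAddCommGroup H] [InnerProductSpace ℂ H] [CompleteSpace H]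
    [NormedAddCommGroup H2] [InnerProductSpace ℂ H2] [CompleteSpace H2]
    [NormedAddCommGroup H3] [InnerProductSpace ℂ H3] [CompleteSpace H3] where
  L : H →L[ℂ] H →L[ℂ] H2
  J : H →L[ℂ] H2 →L[ℂ] H3
  I : H →L[ℂ] H2 →L[ℂ] H3
  P : H →L[ℂ] H2 →L[ℂ] H3
  W : H2 →L[ℂ] H2
  W12 : H3 →L[ℂ] H3
  W13 : H3 →L[ℂ] H3
  W23 : H3 →L[ℂ] H3
  Amp : (H →L[ℂ] H) →L[ℂ] (H2 →L[ℂ] H2)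
  dense : Dense (Submodule.span ℂ {z : H2 | ∃ a b, z = L a b} : Set H2)
  LL : ∀ x y, adjoint (L x) ∘L L y = ⟪x, y⟫_ℂ • (1 : H →L[ℂ] H)
  RR : ∀ x y, adjoint (L.flip x) ∘L L.flip y = ⟪x, y⟫_ℂ • (1 : H →L[ℂ] H)
  JJ : ∀ x y, adjoint (J x) ∘L J y = ⟪x, y⟫_ℂ • (1 : H2 →L[ℂ] H2)
  II : ∀ x y, adjoint (I x) ∘L I y = ⟪x, y⟫_ℂ • (1 : H2 →L[ℂ] H2)
  PP : ∀ x y, adjoint (P x) ∘L P y = ⟪x, y⟫_ℂ • (1 : H2 →L[ℂ] H2)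
  JL : ∀ a b c, J a (L b c) = P c (L a b)
  IL : ∀ a b c, I b (L a c) = P c (L a b)
  WW : adjoint W ∘L W = 1
  WW' : W ∘L adjoint W = 1
  W12W12 : adjoint W12 ∘L W12 = 1
  W23W23 : adjoint W23 ∘L W23 = 1
  W23W23' : W23 ∘L adjoint W23 = 1
  W12P : ∀ x, W12 ∘L P x = P x ∘L W
  W12P' : ∀ x, adjoint W12 ∘L P x = P x ∘L adjoint W
  W13I : ∀ x, W13 ∘L I x = I x ∘L W
  W13I' : ∀ x, adjoint W13 ∘L I x = I x ∘L adjoint W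
  W23J : ∀ x, W23 ∘L J x = J x ∘L W
  W23J' : ∀ x, adjoint W23 ∘L J x = J x ∘L adjoint W
  pent : W23 ∘L W12 = W12 ∘L W13 ∘L W23
  amp : ∀ c a b, Amp c (L a b) = L (c a) b
  amp_le : ∀ c, ‖Amp c‖ ≤ ‖c‖

namespace Sys

variable (s : Sys H H2 H3)

lemma pw {T T' : K →L[ℂ] K'} (h : T = T') (v : K) : T v = T' v := by rw [h]

lemma LLv (x y v) : adjoint (s.L x) (s.L y v) = ⟪x, y⟫_ℂ • v := pw (s.LL x y) v
lemma RRv (x y v) : adjoint (s.L.flip x) (s.L v y) = ⟪x, y⟫_ℂ • v := pw (s.RR x y) v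
lemma JJv (x y v) : adjoint (s.J x) (s.J y v) = ⟪x, y⟫_ℂ • v := pw (s.JJ x y) v
lemma IIv (x y v) : adjoint (s.I x) (s.I y v) = ⟪x, y⟫_ℂ • v := pw (s.II x y) v
lemma PPv (x y v) : adjoint (s.P x) (s.P y v) = ⟪x, y⟫_ℂ • v := pw (s.PP x y) v
lemma WWv (v) : adjoint s.W (s.W v) = v := pw s.WW v
lemma WWv' (v) : s.W (adjoint s.W v) = v := pw s.WW' v
lemma W12v (v) : adjoint s.W12 (s.W12 v) = v := pw s.W12W12 v
lemma W23v (v) : adjoint s.W23 (s.W23 v) = v := pw s.W23W23 v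
lemma W23v' (v) : s.W23 (adjoint s.W23 v) = v := pw s.W23W23' v
lemma W12Pv (x v) : s.W12 (s.P x v) = s.P x (s.W v) := pw (s.W12P x) v
lemma W12Pv' (x v) : adjoint s.W12 (s.P x v) = s.P x (adjoint s.W v) := pw (s.W12P' x) v
lemma W13Iv (x v) : s.W13 (s.I x v) = s.I x (s.W v) := pw (s.W13I x) v
lemma W13Iv' (x v) : adjoint s.W13 (s.I x v) = s.I x (adjoint s.W v) := pw (s.W13I' x) v
lemma W23Jv (x v) : s.W23 (s.J x v) = s.J x (s.W v) := pw (s.W23J x) v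
lemma W23Jv' (x v) : adjoint s.W23 (s.J x v) = s.J x (adjoint s.W v) := pw (s.W23J' x) v
lemma pentv (v) : s.W23 (s.W12 v) = s.W12 (s.W13 (s.W23 v)) := pw s.pent v
lemma pentv' (v) : adjoint s.W12 (s.W23 (s.W12 v)) = s.W13 (s.W23 v) := by
  rw [pentv, W12v]
lemma pentv'' (v) : adjoint s.W12 (adjoint s.W23 v) =
    adjoint s.W23 (adjoint s.W13 (adjoint s.W12 v)) := by
  have h := congrArg adjoint s.pent
  simp only [ContinuousLinearMap.adjoint_comp] at h
  exact pw h v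

lemma IW13 (x v) : adjoint (s.I x) (s.W13 v) = s.W (adjoint (s.I x) v) := by
  have h := congrArg adjoint (s.W13I' x)
  simp only [ContinuousLinearMap.adjoint_comp, ContinuousLinearMap.adjoint_adjoint] at h
  exact pw h v
lemma JW23 (x v) : adjoint (s.J x) (s.W23 v) = s.W (adjoint (s.J x) v) := by
  have h := congrArg adjoint (s.W23J' x)
  simp only [ContinuousLinearMap.adjoint_comp, ContinuousLinearMap.adjoint_adjoint] at h
  exact pw h v

lemma ext2 {Y : Type*} [NormedAddCommGroup Y] [NormedSpace ℂ Y]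
    (f g : H2 →L[ℂ] Y) (h : ∀ a b, f (s.L a b) = g (s.L a b)) : f = g := by
  apply ext_dense s.dense
  rintro _ ⟨a, b, rfl⟩
  exact h a b

lemma JI (x y z) : adjoint (s.J x) (s.I y z) = s.L y (adjoint (s.L x) z) := by
  have : adjoint (s.J x) ∘L s.I y = s.L y ∘L adjoint (s.L x) := by
    apply s.ext2
    intro a b
    simp [IL, ← JL, JJv, LLv]
  exact pw this z

lemma IJ (x y z) : adjoint (s.I y) (s.J x z) = s.L x (adjoint (s.L y) z) := by
  have : adjoint (s.J x) ∘L s.I y = s.L y ∘L adjoint (s.L x) := by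
    ext v
    exact s.JI x y v
  have h := congrArg adjoint this
  simp only [ContinuousLinearMap.adjoint_comp, ContinuousLinearMap.adjoint_adjoint] at h
  exact pw h z

lemma JP (x c z) : adjoint (s.J x) (s.P c z) = s.L (adjoint (s.L x) z) c := by
  have : adjoint (s.J x) ∘L s.P c = s.L.flip c ∘L adjoint (s.L x) := by
    apply s.ext2
    intro a b
    simp [← JL, JJv, LLv]
  exact pw this z

lemma IP (x c z) : adjoint (s.I x) (s.P c z) = s.L (adjoint (s.L.flip x) z) c := by
  have : adjoint (s.I x) ∘L s.P c = s.L.flip c ∘L adjoint (s.L.flip x) := by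
    apply s.ext2
    intro a b
    simp [← IL, IIv, RRv]
  exact pw this z

/-- the slice `a_{ξ,η}` -/
def a (ξ η : H) : H →L[ℂ] H := adjoint (s.L ξ) ∘L s.W ∘L s.L η

lemma a_apply (ξ η v : H) : s.a ξ η v = adjoint (s.L ξ) (s.W (s.L η v)) := rfl

lemma adj_a (ξ η : H) : adjoint (s.a ξ η) = adjoint (s.L η) ∘L adjoint s.W ∘L s.L ξ := by
  simp only [a, ContinuousLinearMap.adjoint_comp, ContinuousLinearMap.adjoint_adjoint]
  rfl

lemma adj_a_apply (ξ η v : H) :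
    adjoint (s.a ξ η) v = adjoint (s.L η) (adjoint s.W (s.L ξ v)) := by
  rw [adj_a]; rfl

lemma amp_a (ξ η : H) (v : H2) :
    s.Amp (s.a ξ η) v = adjoint (s.J ξ) (s.W12 (s.J η v)) := by
  have : s.Amp (s.a ξ η) = adjoint (s.J ξ) ∘L s.W12 ∘L s.J η := by
    apply s.ext2
    intro x y
    simp [amp, JL, W12Pv, JP, a_apply]
  exact pw this v

lemma amp_a' (ξ η : H) (v : H2) :
    s.Amp (adjoint (s.a ξ η)) v = adjoint (s.J η) (adjoint s.W12 (s.J ξ v)) := by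
  have : s.Amp (adjoint (s.a ξ η)) = adjoint (s.J η) ∘L adjoint s.W12 ∘L s.J ξ := by
    apply s.ext2
    intro x y
    simp [amp, JL, W12Pv', JP, adj_a_apply]
  exact pw this v

lemma amp_R (ξ ζ : H) (v : H2) :
    s.Amp (adjoint (s.L.flip ξ) ∘L adjoint s.W ∘L s.L ζ) v =
      adjoint (s.I ξ) (adjoint s.W12 (s.J ζ v)) := by
  have : s.Amp (adjoint (s.L.flip ξ) ∘L adjoint s.W ∘L s.L ζ) =
      adjoint (s.I ξ) ∘L adjoint s.W12 ∘L s.J ζ := by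
    apply s.ext2
    intro x y
    simp [amp, JL, W12Pv', IP]
  exact pw this v

lemma amp_mul (c d : H →L[ℂ] H) (v : H2) : s.Amp (c ∘L d) v = s.Amp c (s.Amp d v) := by
  have : s.Amp (c ∘L d) = s.Amp c ∘L s.Amp d := by
    apply s.ext2
    intro x y
    simp [amp]
  exact pw this v

lemma amp_rank (x y : H) (v : H2) :
    s.Amp ((innerSL ℂ y).smulRight x) v = s.L x (adjoint (s.L y) v) := by
  have : s.Amp ((innerSL ℂ y).smulRight x) = s.L x ∘L adjoint (s.L y) := by
    apply s.ext2
    intro x y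
    simp [amp, LLv]
  exact pw this v

lemma adj_rank (x y : H) : adjoint ((innerSL ℂ y).smulRight x) = (innerSL ℂ x).smulRight y := by
  symm
  rw [ContinuousLinearMap.eq_adjoint_iff]
  intro u v
  simp [inner_smul_left, inner_smul_right, mul_comm]

/-- `N z c = z ⊗ c` -/
def N : H2 →L[ℂ] H →L[ℂ] H3 := s.P.flip

lemma N_apply (z c) : s.N z c = s.P c z := rfl

lemma N_J (x y) : s.N (s.L x y) = s.J x ∘L s.L y := by
  ext v; simp [N_apply, JL]

lemma N_I (x y) : s.N (s.L x y) = s.I y ∘L s.L x := by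
  ext v; simp [N_apply, IL]

lemma NN (z w v) : adjoint (s.N w) (s.N z v) = ⟪w, z⟫_ℂ • v := by
  apply ext_inner_left ℂ
  intro u
  rw [ContinuousLinearMap.adjoint_inner_right, N_apply, N_apply,
    ← ContinuousLinearMap.adjoint_inner_right, PPv, inner_smul_right, inner_smul_right, mul_comm]

lemma mem_closure_dense (z : H2) :
    z ∈ (Submodule.span ℂ {z : H2 | ∃ a b, z = s.L a b}).topologicalClosure := by
  have := s.dense z
  exact this

lemma N_ind {Y : Type*} [NormedAddCommGroup Y] [InnerProductSpace ℂ Y]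
    (T : H3 →L[ℂ] Y) (b : X →L[ℂ] H) (P : Submodule ℂ (X →L[ℂ] Y))
    (hP : IsClosed (P : Set (X →L[ℂ] Y)))
    (h : ∀ x y, T ∘L (s.N (s.L x y) ∘L b) ∈ P) (z : H2) : T ∘L (s.N z ∘L b) ∈ P := by
  refine closedSpan_map _ (sand T b ∘L s.N) P hP ?_ z (s.mem_closure_dense z)
  rintro _ ⟨x, y, rfl⟩
  exact h x y

lemma N_ind_adj (S : X →L[ℂ] H3) (P : Submodule ℂ (X →L[ℂ] H))
    (hP : IsClosed (P : Set (X →L[ℂ] H)))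
    (h : ∀ x y, adjoint (s.N (s.L x y)) ∘L S ∈ P) (z : H2) : adjoint (s.N z) ∘L S ∈ P := by
  have h1 := closedSpan_adj_map (K := H) (K' := H3)
    {T | ∃ x y, T = s.N (s.L x y)} (sand (1 : H →L[ℂ] H) S) P hP
    (by rintro _ ⟨x, y, rfl⟩; exact h x y)
  apply h1
  refine closedSpan_map _ s.N _ (Submodule.isClosed_topologicalClosure _) ?_ z
    (s.mem_closure_dense z)
  rintro _ ⟨x, y, rfl⟩
  exact Submodule.le_topologicalClosure _ (Submodule.subset_span ⟨x, y, rfl⟩)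

/-- generators -/
def gen : Set (H →L[ℂ] H) := {T | ∃ ξ η, T = s.a ξ η}

/-- the leg algebra -/
def A : Submodule ℂ (H →L[ℂ] H) := (Submodule.span ℂ s.gen).topologicalClosure

lemma A_closed : IsClosed (s.A : Set (H →L[ℂ] H)) := Submodule.isClosed_topologicalClosure _

lemma a_mem (ξ η) : s.a ξ η ∈ s.A :=
  Submodule.le_topologicalClosure _ (Submodule.subset_span ⟨ξ, η, rfl⟩)

lemma A_map {V : Type*} [NormedAddCommGroup V] [NormedSpace ℂ V]
    (T : (H →L[ℂ] H) →L[ℂ] V)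
    (P : Submodule ℂ V) (hP : IsClosed (P : Set V))
    (h : ∀ ξ η, T (s.a ξ η) ∈ P) : ∀ x ∈ s.A, T x ∈ P := by
  apply closedSpan_map _ T P hP
  rintro _ ⟨ξ, η, rfl⟩
  exact h ξ η

lemma A_adj_map {V : Type*} [NormedAddCommGroup V] [NormedSpace ℂ V]
    (T : (H →L[ℂ] H) →L[ℂ] V)
    (P : Submodule ℂ V) (hP : IsClosed (P : Set V))
    (h : ∀ ξ η, T (adjoint (s.a ξ η)) ∈ P) : ∀ x ∈ s.A, T (adjoint x) ∈ P := by
  apply closedSpan_adj_map _ T P hP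
  rintro _ ⟨ξ, η, rfl⟩
  exact h ξ η

/-- Step 0 -/
lemma NWN (z z' : H2) : adjoint (s.N z) ∘L (s.W23 ∘L s.N z') ∈ s.A := by
  apply s.N_ind_adj _ _ s.A_closed
  intro x y
  have := s.N_ind (adjoint (s.N (s.L x y)) ∘L s.W23) (1 : H →L[ℂ] H) s.A s.A_closed ?_ z'
  · exact this
  intro x' y'
  have h : (adjoint (s.N (s.L x y)) ∘L s.W23) ∘L (s.N (s.L x' y') ∘L (1 : H →L[ℂ] H)) =
      ⟪x, x'⟫_ℂ • s.a y y' := by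
    ext v
    simp [N_J, ContinuousLinearMap.adjoint_comp, W23Jv, JJv, a_apply]
  rw [h]
  exact s.A.smul_mem _ (s.a_mem _ _)

lemma A_mul_gen (ξ η ξ' η') : s.a ξ η ∘L s.a ξ' η' ∈ s.A := by
  have h : s.a ξ η ∘L s.a ξ' η' =
      adjoint (s.N (s.W (s.L ξ ξ'))) ∘L (s.W23 ∘L s.N (s.W (s.L η η'))) := by
    have h1 : ∀ z, s.N (s.W z) = s.W12 ∘L s.N z := by
      intro z; ext v; simp [N_apply, W12Pv]
    ext v
    rw [h1, h1, ContinuousLinearMap.adjoint_comp]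
    simp only [ContinuousLinearMap.comp_apply, pentv']
    rw [N_I s ξ ξ', N_J, ContinuousLinearMap.adjoint_comp]
    simp [W23Jv, IW13, IJ, a_apply]
  rw [h]
  exact s.NWN _ _

lemma A_mul (x y : H →L[ℂ] H) (hx : x ∈ s.A) (hy : y ∈ s.A) : x ∘L y ∈ s.A := by
  refine s.A_map (sand (1 : H →L[ℂ] H) y) s.A s.A_closed ?_ x hx
  intro ξ η
  refine s.A_map (sand (s.a ξ η) (1 : H →L[ℂ] H)) s.A s.A_closed ?_ y hy
  intro ξ' η'
  exact s.A_mul_gen _ _ _ _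

/-- Semi-regularity. -/
def Semi : Prop := ∀ x y : H, (innerSL ℂ y).smulRight x ∈
  (Submodule.span ℂ {T : H →L[ℂ] H | ∃ ξ η, T = adjoint (s.L ξ) ∘L s.W ∘L s.L.flip η}).topologicalClosure

/-- `M S`. -/
def M (S : Submodule ℂ (H →L[ℂ] H)) : Submodule ℂ (H →L[ℂ] H2) := col s.L (S : Set (H →L[ℂ] H))

lemma M_closed (S : Submodule ℂ (H →L[ℂ] H)) : IsClosed (s.M S : Set (H →L[ℂ] H2)) :=
  col_closed _ _

lemma mem_M (S : Submodule ℂ (H →L[ℂ] H)) (ξ c) (hc : c ∈ S) : s.L ξ ∘L c ∈ s.M S :=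
  mem_col s.L _ ξ c hc

lemma step1a (ξ : H) (z : H2) :
    (adjoint s.W ∘L adjoint (s.I ξ) ∘L s.W13 ∘L s.W23) ∘L (s.N z ∘L (1 : H →L[ℂ] H)) ∈ s.M s.A := by
  apply s.N_ind _ _ _ (s.M_closed _)
  intro ζ η
  have : (adjoint s.W ∘L adjoint (s.I ξ) ∘L s.W13 ∘L s.W23) ∘L
      (s.N (s.L ζ η) ∘L (1 : H →L[ℂ] H)) = s.L ζ ∘L s.a ξ η := by
    ext v
    simp [N_J, W23Jv, IW13, IJ, WWv, a_apply]
  rw [this]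
  exact s.mem_M _ _ _ (s.a_mem _ _)

lemma step1b (ξ ζ η : H) :
    adjoint s.W ∘L s.Amp (adjoint (s.L.flip ξ) ∘L adjoint s.W ∘L s.L ζ) ∘L s.W ∘L s.L η
      ∈ s.M s.A := by
  have := s.step1a ξ (adjoint s.W (s.L ζ η))
  convert this using 1
  ext v
  have h2 : s.W12 (s.N (adjoint s.W (s.L ζ η)) v) = s.J ζ (s.L η v) := by
    simp [N_apply, W12Pv, WWv', JL]
  simp [amp_R, ← pentv', h2, W23Jv]

lemma step1 (hs : s.Semi) (x : H) (c : H →L[ℂ] H) (hc : c ∈ s.A) :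
    adjoint s.W ∘L s.L x ∘L c ∈ s.M s.A := by
  have := s.A_map (sand (adjoint s.W ∘L s.L x) (1 : H →L[ℂ] H)) (s.M s.A) (s.M_closed _) ?_ c hc
  · exact this
  intro y η
  have h := closedSpan_adj_map _ (sand (adjoint s.W) (s.W ∘L s.L η) ∘L s.Amp) (s.M s.A)
    (s.M_closed _) ?_ _ (hs y x)
  · convert h using 1
    ext v
    simp [sand_apply, adj_rank, amp_rank, a_apply, -coe_smulRight]
  · rintro _ ⟨ξ, ζ, rfl⟩
    have := s.step1b ζ ξ η
    convert this using 1
    simp [sand_apply, ContinuousLinearMap.adjoint_comp]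
    rfl

/-- the `*`-algebra `[A* A]` -/
def B : Submodule ℂ (H →L[ℂ] H) :=
  (Submodule.span ℂ {T | ∃ c ∈ s.A, ∃ d ∈ s.A, T = adjoint c ∘L d}).topologicalClosure

lemma B_closed : IsClosed (s.B : Set (H →L[ℂ] H)) := Submodule.isClosed_topologicalClosure _

lemma mem_B (c d) (hc : c ∈ s.A) (hd : d ∈ s.A) : adjoint c ∘L d ∈ s.B :=
  Submodule.le_topologicalClosure _ (Submodule.subset_span ⟨c, hc, d, hd, rfl⟩)

lemma B_map {V : Type*} [NormedAddCommGroup V] [NormedSpace ℂ V]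
    (T : (H →L[ℂ] H) →L[ℂ] V)
    (P : Submodule ℂ V) (hP : IsClosed (P : Set V))
    (h : ∀ c ∈ s.A, ∀ d ∈ s.A, T (adjoint c ∘L d) ∈ P) : ∀ x ∈ s.B, T x ∈ P := by
  apply closedSpan_map _ T P hP
  rintro _ ⟨c, hc, d, hd, rfl⟩
  exact h c hc d hd

lemma B_le_A (hs : s.Semi) : s.B ≤ s.A := by
  intro x hx
  refine s.B_map (1 : (H →L[ℂ] H) →L[ℂ] (H →L[ℂ] H)) s.A s.A_closed ?_ x hx
  intro c hc d hd
  refine s.A_adj_map (sand (1 : H →L[ℂ] H) d) s.A s.A_closed ?_ c hc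
  intro ξ η
  have h := col_comp s.L _ (adjoint (s.L η)) s.A s.A_closed ?_ _ (s.step1 hs ξ d hd)
  · rw [adj_a]
    exact h
  · intro ξ c hc
    rw [← ContinuousLinearMap.comp_assoc, s.LL, ContinuousLinearMap.smul_comp]
    exact s.A.smul_mem _ hc

lemma B_adj (x) (hx : x ∈ s.B) : adjoint x ∈ s.B := by
  refine closedSpan_adj_map _ (1 : (H →L[ℂ] H) →L[ℂ] (H →L[ℂ] H)) s.B s.B_closed ?_ x hx
  rintro _ ⟨c, hc, d, hd, rfl⟩
  simp only [ContinuousLinearMap.adjoint_comp, ContinuousLinearMap.adjoint_adjoint]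
  exact s.mem_B _ _ hd hc

lemma AsB (c x) (hc : c ∈ s.A) (hx : x ∈ s.B) : adjoint c ∘L x ∈ s.B := by
  refine s.B_map (sand (adjoint c) (1 : H →L[ℂ] H)) s.B s.B_closed ?_ x hx
  intro d hd e he
  have := s.mem_B (d ∘L c) e (s.A_mul _ _ hd hc) he
  rw [ContinuousLinearMap.adjoint_comp] at this
  exact this

lemma BA (c x) (hc : c ∈ s.A) (hx : x ∈ s.B) : x ∘L c ∈ s.B := by
  refine s.B_map (sand (1 : H →L[ℂ] H) c) s.B s.B_closed ?_ x hx
  intro d hd e he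
  exact s.mem_B d (e ∘L c) hd (s.A_mul _ _ he hc)

lemma BB (hs : s.Semi) (x y) (hx : x ∈ s.B) (hy : y ∈ s.B) : x ∘L y ∈ s.B :=
  s.BA y x (s.B_le_A hs hy) hx

lemma M_mono {S S' : Submodule ℂ (H →L[ℂ] H)} (h : S ≤ S') : s.M S ≤ s.M S' :=
  col_mono _ h

/-- Step 3 -/
lemma step3 (hs : s.Semi) (x : H →L[ℂ] H2) (hx : x ∈ s.M s.A) :
    adjoint s.W ∘L x ∈ s.M s.B := by
  refine col_comp s.L _ (adjoint s.W) _ (s.M_closed _) ?_ x hx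
  intro ξ c hc
  apply mem_col_of_slices s.L s.LL
  · exact col_mono _ (Set.subset_univ _) (s.step1 hs ξ c hc)
  · intro η
    have := s.mem_B _ _ (s.a_mem ξ η) hc
    rw [adj_a] at this
    exact this

/-- Step 4 -/
lemma step4 (c : H →L[ℂ] H) (hc : c ∈ s.A) (m : H →L[ℂ] H2)
    (hm : m ∈ s.M s.B) : (s.W ∘L s.Amp (adjoint c) ∘L adjoint s.W) ∘L m ∈ s.M s.B := by
  refine col_comp s.L _ _ _ (s.M_closed _) ?_ m hm
  intro ζ b hb
  refine s.A_adj_map (sand s.W (adjoint s.W ∘L s.L ζ ∘L b) ∘L s.Amp) _ (s.M_closed _) ?_ c hc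
  intro ξ η
  have h := s.N_ind (adjoint (s.J η) ∘L adjoint s.W13) b (s.M s.B) (s.M_closed _) ?_
    (adjoint s.W (s.L ξ ζ))
  · convert h using 1
    ext v
    have h2 : s.N (adjoint s.W (s.L ξ ζ)) (b v) = adjoint s.W12 (s.J ξ (s.L ζ (b v))) := by
      simp [N_apply, W12Pv', JL]
    simp [sand_apply, amp_a', ← W23Jv', pentv'', ← JW23, W23v', h2]
  · intro α β
    have h3 : (adjoint (s.J η) ∘L adjoint s.W13) ∘L (s.N (s.L α β) ∘L b) =
        s.L β ∘L (adjoint (s.a α η) ∘L b) := by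
      ext v
      simp [N_I, W13Iv', JI, adj_a_apply]
    rw [h3]
    exact s.mem_M _ _ _ (s.AsB _ _ (s.a_mem _ _) hb)

end Sys

lemma exists_approx (B : Submodule ℂ (H →L[ℂ] H)) (hcl : IsClosed (B : Set (H →L[ℂ] H)))
    (hmul : ∀ x y, x ∈ B → y ∈ B → x ∘L y ∈ B) (hadj : ∀ x ∈ B, adjoint x ∈ B) :
    ∃ l : Filter (H →L[ℂ] H), l.NeBot ∧ (∀ᶠ u in l, u ∈ B ∧ ‖u‖ ≤ 1) ∧
      (∀ b ∈ B, Filter.Tendsto (fun u => u ∘L b) l (𝓝 b)) ∧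
      (∀ b ∈ B, Filter.Tendsto (fun u => b ∘L u) l (𝓝 b)) := by
  let S : NonUnitalStarSubalgebra ℂ (H →L[ℂ] H) :=
    { B with
      mul_mem' := fun {x y} hx hy => hmul x y hx hy
      star_mem' := fun {x} hx => hadj x hx }
  have : IsClosed (S : Set (H →L[ℂ] H)) := hcl
  let : PartialOrder S := CStarAlgebra.spectralOrder S
  have : StarOrderedRing S := CStarAlgebra.spectralOrderedRing S
  have hu := CStarAlgebra.increasingApproximateUnit S
  have := hu.neBot
  refine ⟨(CStarAlgebra.approximateUnit S).map (fun x : S => (x : H →L[ℂ] H)), inferInstance,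
    ?_, ?_, ?_⟩
  · rw [Filter.eventually_map]
    filter_upwards [hu.eventually_norm] with u h
    exact ⟨u.2, h⟩
  · intro b hb
    rw [Filter.tendsto_map'_iff]
    have := (continuous_subtype_val.tendsto _).comp (hu.tendsto_mul_right ⟨b, hb⟩)
    exact this
  · intro b hb
    rw [Filter.tendsto_map'_iff]
    have := (continuous_subtype_val.tendsto _).comp (hu.tendsto_mul_left ⟨b, hb⟩)
    exact this

lemma tendsto_of_span {V ι : Type*} [NormedAddCommGroup V] [NormedSpace ℂ V] (l : Filter ι)
    (F : ι → V →L[ℂ] V) (hF : ∀ᶠ i in l, ‖F i‖ ≤ 1) (S : Set V)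
    (h : ∀ v ∈ S, Filter.Tendsto (fun i => F i v) l (𝓝 v)) :
    ∀ v ∈ (Submodule.span ℂ S).topologicalClosure, Filter.Tendsto (fun i => F i v) l (𝓝 v) := by
  have h1 : ∀ v ∈ Submodule.span ℂ S, Filter.Tendsto (fun i => F i v) l (𝓝 v) := by
    intro v hv
    refine Submodule.span_induction h ?_ ?_ ?_ hv
    · simpa using tendsto_const_nhds
    · intro x y _ _ hx hy
      simpa using hx.add hy
    · intro c x _ hx
      simpa using hx.const_smul c
  intro v hv
  have hv' : v ∈ closure (Submodule.span ℂ S : Set V) := hv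
  rw [Metric.tendsto_nhds]
  intro ε hε
  obtain ⟨w, hw, hvw⟩ := Metric.mem_closure_iff.mp hv' (ε / 3) (by positivity)
  filter_upwards [hF, Metric.tendsto_nhds.mp (h1 w hw) (ε / 3) (by positivity)] with i hi hi2
  have h3 : dist (F i v) (F i w) ≤ dist v w := by
    rw [dist_eq_norm, dist_eq_norm, ← map_sub]
    calc _ ≤ ‖F i‖ * ‖v - w‖ := (F i).le_opNorm _
      _ ≤ 1 * ‖v - w‖ := by gcongr
      _ = _ := one_mul _
  have h4 := dist_triangle4 (F i v) (F i w) w v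
  rw [dist_comm w v] at h4
  linarith

namespace Sys

variable (s : Sys H H2 H3)

lemma eq_zero_of_inner (w : H2) (h : ∀ x y, ⟪w, s.L x y⟫_ℂ = 0) : w = 0 := by
  apply eq_of_inner_dense s.dense
  rintro _ ⟨x, y, rfl⟩
  rw [inner_zero_right, ← inner_conj_symm, h, map_zero]

lemma eq_zero_of_L (v : H) (h : s.L v v = 0) : v = 0 := by
  have h1 := s.LLv v v v
  rw [h, map_zero] at h1
  rcases smul_eq_zero.mp h1.symm with h | h
  · exact inner_self_eq_zero.mp h
  · exact h

lemma nondeg1 (χ : H) (h : ∀ ξ η v, ⟪χ, s.a ξ η v⟫_ℂ = 0) : χ = 0 := by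
  apply s.eq_zero_of_L
  have h1 : adjoint s.W (s.L χ χ) = 0 := by
    apply s.eq_zero_of_inner
    intro x y
    have := h χ x y
    rw [a_apply, ContinuousLinearMap.adjoint_inner_right] at this
    rw [ContinuousLinearMap.adjoint_inner_left]
    exact this
  rw [← s.WWv' (s.L χ χ), h1, map_zero]

lemma nondeg2 (χ : H) (h : ∀ ξ η, s.a ξ η χ = 0) : χ = 0 := by
  apply s.eq_zero_of_L
  have h1 : s.W (s.L χ χ) = 0 := by
    apply s.eq_zero_of_inner
    intro x y
    have := h x χ
    have h2 : ⟪s.a x χ χ, y⟫_ℂ = 0 := by rw [this, inner_zero_left]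
    rw [a_apply, ContinuousLinearMap.adjoint_inner_left] at h2
    exact h2
  rw [← s.WWv (s.L χ χ), h1, map_zero]

lemma B_dense (v : H) :
    v ∈ (Submodule.span ℂ {w : H | ∃ b ∈ s.B, ∃ u, w = b u}).topologicalClosure := by
  have h : (Submodule.span ℂ {w : H | ∃ b ∈ s.B, ∃ u, w = b u}).topologicalClosure = ⊤ := by
    rw [Submodule.topologicalClosure_eq_top_iff, Submodule.eq_bot_iff]
    intro χ hχ
    rw [Submodule.mem_orthogonal'] at hχ
    apply s.nondeg2
    intro ξ η
    apply s.nondeg1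
    intro ξ' η' v
    rw [← ContinuousLinearMap.adjoint_inner_right]
    apply hχ
    apply Submodule.subset_span
    exact ⟨adjoint (s.a ξ η) ∘L s.a ξ' η', s.mem_B _ _ (s.a_mem _ _) (s.a_mem _ _), v, rfl⟩
  rw [h]
  trivial

/-- Step 5 -/
lemma step5 (hs : s.Semi) (c : H →L[ℂ] H) (hc : c ∈ s.A) (r : H →L[ℂ] H2)
    (hr : s.W ∘L r ∈ s.M s.B) : s.W ∘L (s.Amp c ∘L r) ∈ s.M s.B := by
  obtain ⟨l, hl, hu, hul, -⟩ := exists_approx s.B s.B_closed (s.BB hs) s.B_adj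
  have hv : ∀ v : H, Filter.Tendsto (fun u : H →L[ℂ] H => u v) l (𝓝 v) := by
    intro v
    refine tendsto_of_span l (fun u => u) (hu.mono fun u h => h.2) _ ?_ v (s.B_dense v)
    rintro _ ⟨b, hb, u, rfl⟩
    exact ((ContinuousLinearMap.apply ℂ H u).continuous.tendsto _).comp (hul b hb)
  have hrR : ∀ b ∈ s.B, ∀ r : H →L[ℂ] H2, s.W ∘L r ∈ s.M s.B →
      s.W ∘L (s.Amp b ∘L r) ∈ s.M s.B := by
    intro b hb r hr
    have := s.step4 (adjoint b) (s.B_le_A hs (s.B_adj b hb)) _ hr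
    convert this using 1
    ext v
    simp [WWv]
  have hrM : r ∈ s.M s.B := by
    have := s.step3 hs _ (s.M_mono (s.B_le_A hs) hr)
    convert this using 1
    ext v
    simp [WWv]
  have hcr : s.Amp c ∘L r ∈ col s.L (Set.univ : Set (H →L[ℂ] H)) := by
    refine col_comp s.L _ (s.Amp c) _ (col_closed _ _) ?_ r hrM
    intro ξ b hb
    have : s.Amp c ∘L s.L ξ ∘L b = s.L (c ξ) ∘L b := by
      ext v; simp [amp]
    rw [this]
    exact mem_col _ _ _ _ (Set.mem_univ _)
  have ht : Filter.Tendsto (fun u => s.Amp u ∘L (s.Amp c ∘L r)) l (𝓝 (s.Amp c ∘L r)) := by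
    refine tendsto_of_span l (fun u => compL ℂ H H2 H2 (s.Amp u)) ?_ _ ?_ _ hcr
    · filter_upwards [hu] with u h
      refine ContinuousLinearMap.opNorm_le_bound _ zero_le_one ?_
      intro x
      calc _ ≤ ‖s.Amp u‖ * ‖x‖ := ContinuousLinearMap.opNorm_comp_le _ _
        _ ≤ 1 * ‖x‖ := by
          gcongr
          exact (s.amp_le u).trans h.2
    · rintro _ ⟨ξ, b, -, rfl⟩
      have h1 : ∀ u, compL ℂ H H2 H2 (s.Amp u) (s.L ξ ∘L b) =
          ((compL ℂ H H H2).flip b ∘L s.L) (u ξ) := by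
        intro u; ext v; simp [amp]
      simp only [h1]
      exact (((compL ℂ H H H2).flip b ∘L s.L).continuous.tendsto _).comp (hv ξ)
  have ht2 := ((compL ℂ H H2 H2 s.W).continuous.tendsto _).comp ht
  refine (s.M_closed s.B).mem_of_tendsto ht2 ?_
  filter_upwards [hu] with u h
  have := hrR (u ∘L c) (s.BA c u hc h.1) r hr
  have h2 : s.Amp u ∘L (s.Amp c ∘L r) = s.Amp (u ∘L c) ∘L r := by
    ext v; simp [amp_mul]
  simp only [Function.comp_apply, h2]
  exact this

/-- three-leg module -/
def M3 : Submodule ℂ (H →L[ℂ] H3) := col s.J (s.M s.B : Set (H →L[ℂ] H2))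

lemma M3_closed : IsClosed (s.M3 : Set (H →L[ℂ] H3)) := col_closed _ _

lemma N_mem_M3 (z : H2) (b) (hb : b ∈ s.B) : s.N z ∘L b ∈ s.M3 := by
  refine s.N_ind (1 : H3 →L[ℂ] H3) b s.M3 s.M3_closed ?_ z
  intro x y
  have : (1 : H3 →L[ℂ] H3) ∘L (s.N (s.L x y) ∘L b) = s.J x ∘L (s.L y ∘L b) := by
    rw [N_J]; rfl
  rw [this]
  exact mem_col _ _ _ _ (s.mem_M _ _ _ hb)

lemma M3_ind {Y : Type*} [NormedAddCommGroup Y] [InnerProductSpace ℂ Y] (T : H3 →L[ℂ] Y)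
    (P : Submodule ℂ (H →L[ℂ] Y)) (hP : IsClosed (P : Set (H →L[ℂ] Y)))
    (h : ∀ z, ∀ b ∈ s.B, T ∘L (s.N z ∘L b) ∈ P) (x) (hx : x ∈ s.M3) : T ∘L x ∈ P := by
  refine col_comp s.J _ T P hP ?_ x hx
  intro ξ m hm
  refine col_comp s.L _ (T ∘L s.J ξ) P hP ?_ m hm
  intro ζ b hb
  have := h (s.L ξ ζ) b hb
  rw [N_J] at this
  exact this

lemma W12_M3 (x) (hx : x ∈ s.M3) : s.W12 ∘L x ∈ s.M3 := by
  refine s.M3_ind _ _ s.M3_closed ?_ x hx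
  intro z b hb
  have : s.W12 ∘L (s.N z ∘L b) = s.N (s.W z) ∘L b := by
    ext v; simp [N_apply, W12Pv]
  rw [this]
  exact s.N_mem_M3 _ _ hb

lemma W12_M3' (x) (hx : x ∈ s.M3) : adjoint s.W12 ∘L x ∈ s.M3 := by
  refine s.M3_ind _ _ s.M3_closed ?_ x hx
  intro z b hb
  have : adjoint s.W12 ∘L (s.N z ∘L b) = s.N (adjoint s.W z) ∘L b := by
    ext v; simp [N_apply, W12Pv']
  rw [this]
  exact s.N_mem_M3 _ _ hb

/-- Step 6 -/
lemma step6 (hs : s.Semi) (η ζ : H) (b) (hb : b ∈ s.B) :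
    s.W13 ∘L (s.N (s.L η ζ) ∘L b) ∈ s.M3 := by
  have hm : adjoint s.W ∘L (s.L ζ ∘L b) ∈ s.M s.B :=
    s.step3 hs _ (s.M_mono (s.B_le_A hs) (s.mem_M _ _ _ hb))
  have hy : s.W12 ∘L (s.J η ∘L (adjoint s.W ∘L (s.L ζ ∘L b))) ∈ s.M3 :=
    s.W12_M3 _ (mem_col _ _ _ _ hm)
  have hy2 : s.W12 ∘L (s.J η ∘L (adjoint s.W ∘L (s.L ζ ∘L b))) ∈
      col s.J {r : H →L[ℂ] H2 | s.W ∘L r ∈ s.M s.B} := by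
    apply mem_col_of_slices s.J s.JJ
    · exact col_mono _ (Set.subset_univ _) hy
    · intro ξ
      have h := s.step5 hs (s.a ξ η) (s.a_mem _ _) (adjoint s.W ∘L (s.L ζ ∘L b)) ?_
      · have h2 : adjoint (s.J ξ) ∘L (s.W12 ∘L (s.J η ∘L (adjoint s.W ∘L (s.L ζ ∘L b)))) =
            s.Amp (s.a ξ η) ∘L (adjoint s.W ∘L (s.L ζ ∘L b)) := by
          ext v; simp [amp_a]
        rw [h2]
        exact h
      · have h2 : s.W ∘L (adjoint s.W ∘L (s.L ζ ∘L b)) = s.L ζ ∘L b := by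
          ext v; simp [WWv']
        rw [h2]
        exact s.mem_M _ _ _ hb
  have hy3 := col_comp s.J _ s.W23 s.M3 s.M3_closed ?_ _ hy2
  · have := s.W12_M3' _ hy3
    convert this using 1
    ext v
    simp [← W23Jv', pentv', W23v', N_J]
  · intro ξ r hr
    have h2 : s.W23 ∘L (s.J ξ ∘L r) = s.J ξ ∘L (s.W ∘L r) := by
      ext v; simp [W23Jv]
    rw [h2]
    exact mem_col s.J _ ξ _ hr

lemma AB (hs : s.Semi) (c b) (hc : c ∈ s.A) (hb : b ∈ s.B) : c ∘L b ∈ s.B := by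
  refine s.A_map (sand (1 : H →L[ℂ] H) b) s.B s.B_closed ?_ c hc
  intro ξ η
  by_cases hη : η = 0
  · have : s.a ξ η = 0 := by ext v; simp [a_apply, hη]
    rw [this, map_zero]
    exact s.B.zero_mem
  have h := s.M3_ind (adjoint (s.N (s.L ξ η))) s.B s.B_closed ?_ _ (s.step6 hs η η b hb)
  · have h2 : adjoint (s.N (s.L ξ η)) ∘L (s.W13 ∘L (s.N (s.L η η) ∘L b)) =
        ⟪η, η⟫_ℂ • (s.a ξ η ∘L b) := by
      ext v
      simp [N_I, ContinuousLinearMap.adjoint_comp, W13Iv, IIv, a_apply]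
    rw [h2] at h
    have h3 : ⟪η, η⟫_ℂ ≠ 0 := fun h => hη (inner_self_eq_zero.mp h)
    exact (s.B.smul_mem_iff h3).mp h
  · intro z b hb
    have h2 : adjoint (s.N (s.L ξ η)) ∘L (s.N z ∘L b) = ⟪s.L ξ η, z⟫_ℂ • b := by
      ext v; simp [NN]
    rw [h2]
    exact s.B.smul_mem _ hb

lemma A_le_B (hs : s.Semi) : s.A ≤ s.B := by
  intro c hc
  obtain ⟨l, hl, hu, -, hur⟩ := exists_approx s.B s.B_closed (s.BB hs) s.B_adj
  have hlim : Filter.Tendsto (fun u => c ∘L u) l (𝓝 c) := by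
    rw [tendsto_iff_norm_sub_tendsto_zero]
    have h1 := (tendsto_iff_norm_sub_tendsto_zero.mp (hur _ (s.mem_B c c hc hc))).const_mul 2
    rw [mul_zero] at h1
    have h2 := h1.sqrt
    rw [Real.sqrt_zero] at h2
    refine squeeze_zero' (Filter.Eventually.of_forall fun u => norm_nonneg _) ?_ h2
    filter_upwards [hu] with u h
    apply Real.le_sqrt_of_sq_le
    rw [sq, ← ContinuousLinearMap.norm_adjoint_comp_self]
    have h3 : adjoint (c ∘L u - c) ∘L (c ∘L u - c) =
        (adjoint u - 1) ∘L ((adjoint c ∘L c) ∘L u - adjoint c ∘L c) := by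
      rw [map_sub, ContinuousLinearMap.adjoint_comp]
      ext v; simp
    rw [h3]
    refine (ContinuousLinearMap.opNorm_comp_le _ _).trans ?_
    gcongr
    refine (norm_sub_le _ _).trans ?_
    have h4 : ‖adjoint u‖ ≤ 1 := by
      rw [LinearIsometryEquiv.norm_map]; exact h.2
    have h5 : ‖(1 : H →L[ℂ] H)‖ ≤ 1 := ContinuousLinearMap.norm_id_le
    linarith
  refine s.B_closed.mem_of_tendsto hlim ?_
  filter_upwards [hu] with u h
  exact s.AB hs c u hc h.1

lemma A_adj (hs : s.Semi) (c) (hc : c ∈ s.A) : adjoint c ∈ s.A :=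
  s.B_le_A hs (s.B_adj _ (s.A_le_B hs hc))

end Sys

/-- `(a, b, c) ↦ T c a b` -/
def swapT1 (T : H →ₗ[ℂ] H →ₗ[ℂ] H →ₗ[ℂ] H3) : H →ₗ[ℂ] H →ₗ[ℂ] H →ₗ[ℂ] H3 :=
  LinearMap.mk₂ ℂ (fun a b => (T.flip a).flip b)
    (by intros; ext; simp) (by intros; ext; simp) (by intros; ext; simp) (by intros; ext; simp)

lemma swapT1_apply (T : H →ₗ[ℂ] H →ₗ[ℂ] H →ₗ[ℂ] H3) (a b c : H) :
    swapT1 T a b c = T c a b := rfl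

/-- `(a, b, c) ↦ T a c b` -/
def swapT2 (T : H →ₗ[ℂ] H →ₗ[ℂ] H →ₗ[ℂ] H3) : H →ₗ[ℂ] H →ₗ[ℂ] H →ₗ[ℂ] H3 :=
  LinearMap.mk₂ ℂ (fun a b => (T a).flip b)
    (by intros; ext; simp) (by intros; ext; simp) (by intros; ext; simp) (by intros; ext; simp)

lemma swapT2_apply (T : H →ₗ[ℂ] H →ₗ[ℂ] H →ₗ[ℂ] H3) (a b c : H) :
    swapT2 T a b c = T a c b := rfl

lemma isCompact_rank (x y : H) :
    IsCompactOperator ((innerSL ℂ y).smulRight x : H →L[ℂ] H) := by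
  have h1 : IsCompactOperator (innerSL ℂ y : H →L[ℂ] ℂ) := by
    refine ⟨Metric.closedBall 0 1, isCompact_closedBall _ _, ?_⟩
    exact (innerSL ℂ y).continuous.continuousAt.preimage_mem_nhds
      (by rw [map_zero]; exact Metric.closedBall_mem_nhds _ one_pos)
  have h2 := h1.clm_comp (ContinuousLinearMap.toSpanSingleton ℂ x)
  exact h2

end Aux

/-- If `W` is a bi-semi-regular multiplicative unitary on `H`,
then `A(W)` is a C*-subalgebra of `B(H)`. -/
theorem statement5
    {H H2 H3 : Type*}
    [NormedAddCommGroup H] [InnerProductSpace ℂ H] [CompleteSpace H]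
    [NormedAddCommGroup H2] [InnerProductSpace ℂ H2] [CompleteSpace H2]
    [NormedAddCommGroup H3] [InnerProductSpace ℂ H3] [CompleteSpace H3]
    -- realizations of the tensor products H ⊗ H and H ⊗ H ⊗ H
    (t2 : TensorPair H H H2) (t3 : TensorTriple H H H H3)
    -- W is a unitary on H ⊗ H
    (W : H2 →L[ℂ] H2) (hWu : star W * W = 1 ∧ W * star W = 1)
    -- the legs W₁₂, W₂₃, W₁₃ of W on H ⊗ H ⊗ H
    (W12 W23 W13 : H3 →L[ℂ] H3)
    (hW12 : IsLeg12 t2 t3 W W12) (hW23 : IsLeg23 t2 t3 W W23)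
    (hW13 : IsLeg13 t2 t3 W W13)
    -- the pentagon equation W₂₃W₁₂ = W₁₂W₁₃W₂₃
    (hpent : W23 * W12 = W12 * W13 * W23)
    -- the tensor flip Σ on H ⊗ H
    (Sg : H2 →L[ℂ] H2) (hSg : ∀ a b : H, Sg (t2.tmul a b) = t2.tmul b a)
    -- bi-semi-regularity: K(H) ⊆ C(W) and K(H) ⊆ [(ω_{ξ,η} ⊗ id)(ΣW)]
    (hsemi : {T : H →L[ℂ] H | IsCompactOperator T} ⊆ hatA t2 (Sg * W))
    (hsemi' : {T : H →L[ℂ] H | IsCompactOperator T} ⊆ legA t2 (Sg * W)) :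
    IsClosed (legA t2 W) ∧
    (∀ a ∈ legA t2 W, ∀ b ∈ legA t2 W, a * b ∈ legA t2 W) ∧
    star '' legA t2 W = legA t2 W := by
  obtain ⟨J, hJ, hJJ⟩ := t2.exists_ext (swapT1 t3.tmul) (by
    intro a b c a' b' c'
    simp only [swapT1_apply, t3.inner_tmul]
    ring)
  obtain ⟨I, hI, hII⟩ := t2.exists_ext (swapT2 t3.tmul) (by
    intro a b c a' b' c'
    simp only [swapT2_apply, t3.inner_tmul]
    ring)
  obtain ⟨P, hP, hPP⟩ := t2.exists_ext t3.tmul (by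
    intro a b c a' b' c'
    simp only [t3.inner_tmul])
  simp only [swapT1_apply] at hJ
  simp only [swapT2_apply] at hI
  obtain ⟨Amp, hAmp, hAmp_le⟩ := t2.exists_amp
  have hdJ : Dense (Submodule.span ℂ {z : H3 | ∃ x a b, z = J x (t2.tmul a b)} : Set H3) := by
    refine t3.dense_span.mono (Submodule.span_mono ?_)
    rintro _ ⟨a, b, c, rfl⟩
    exact ⟨a, b, c, (hJ b c a).symm⟩
  have hdI : Dense (Submodule.span ℂ {z : H3 | ∃ x a b, z = I x (t2.tmul a b)} : Set H3) := by
    refine t3.dense_span.mono (Submodule.span_mono ?_)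
    rintro _ ⟨a, b, c, rfl⟩
    exact ⟨b, a, c, (hI a c b).symm⟩
  have hdP : Dense (Submodule.span ℂ {z : H3 | ∃ x a b, z = P x (t2.tmul a b)} : Set H3) := by
    refine t3.dense_span.mono (Submodule.span_mono ?_)
    rintro _ ⟨a, b, c, rfl⟩
    exact ⟨c, a, b, (hP a b c).symm⟩
  have k23 : ∀ x y a b c d, ⟪J x (t2.tmul a b), W23 (J y (t2.tmul c d))⟫_ℂ =
      ⟪t2.tmul a b, W (t2.tmul c d)⟫_ℂ * ⟪x, y⟫_ℂ := by
    intro x y a b c d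
    rw [hJ, hJ, hW23]
  have k13 : ∀ x y a b c d, ⟪I x (t2.tmul a b), W13 (I y (t2.tmul c d))⟫_ℂ =
      ⟪t2.tmul a b, W (t2.tmul c d)⟫_ℂ * ⟪x, y⟫_ℂ := by
    intro x y a b c d
    rw [hI, hI, hW13]
  have k12 : ∀ x y a b c d, ⟪P x (t2.tmul a b), W12 (P y (t2.tmul c d))⟫_ℂ =
      ⟪t2.tmul a b, W (t2.tmul c d)⟫_ℂ * ⟪x, y⟫_ℂ := by
    intro x y a b c d
    rw [hP, hP, hW12]
  have hWW : adjoint W ∘L W = 1 := hWu.1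
  have hWW' : W ∘L adjoint W = 1 := hWu.2
  let s : Sys H H2 H3 :=
    { L := t2.L
      J := J
      I := I
      P := P
      W := W
      W12 := W12
      W13 := W13
      W23 := W23
      Amp := Amp
      dense := t2.dense_span
      LL := by
        intro x y
        ext v
        apply ext_inner_left ℂ
        intro w
        simp [ContinuousLinearMap.adjoint_inner_right, t2.L_apply, t2.inner_tmul,
          inner_smul_right]
      RR := by
        intro x y
        ext v
        apply ext_inner_left ℂ
        intro w
        simp [ContinuousLinearMap.adjoint_inner_right, t2.L_apply, t2.inner_tmul,
          inner_smul_right, mul_comm]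
      JJ := hJJ
      II := hII
      PP := hPP
      JL := by
        intro a b c
        rw [t2.L_apply, t2.L_apply, hJ, hP]
      IL := by
        intro a b c
        rw [t2.L_apply, t2.L_apply, hI, hP]
      WW := hWW
      WW' := hWW'
      W12W12 := leg_unitary t2 P hdP W (adjoint W) W12 (adjoint W12)
        (leg_intertwine t2 P hPP hdP W W12 k12) (leg_intertwine' t2 P hPP hdP W W12 k12) hWW
      W23W23 := leg_unitary t2 J hdJ W (adjoint W) W23 (adjoint W23)
        (leg_intertwine t2 J hJJ hdJ W W23 k23) (leg_intertwine' t2 J hJJ hdJ W W23 k23) hWW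
      W23W23' := leg_unitary t2 J hdJ (adjoint W) W (adjoint W23) W23
        (leg_intertwine' t2 J hJJ hdJ W W23 k23) (leg_intertwine t2 J hJJ hdJ W W23 k23) hWW'
      W12P := leg_intertwine t2 P hPP hdP W W12 k12
      W12P' := leg_intertwine' t2 P hPP hdP W W12 k12
      W13I := leg_intertwine t2 I hII hdI W W13 k13
      W13I' := leg_intertwine' t2 I hII hdI W W13 k13
      W23J := leg_intertwine t2 J hJJ hdJ W W23 k23
      W23J' := leg_intertwine' t2 J hJJ hdJ W W23 k23
      pent := hpent
      amp := hAmp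
      amp_le := hAmp_le }
  have hgen : slicesL t2 t2 W = s.gen := by
    ext T
    constructor
    · rintro ⟨ξ, η, h⟩
      refine ⟨ξ, η, ?_⟩
      ext v
      apply ext_inner_left ℂ
      intro w
      rw [h, s.a_apply, ContinuousLinearMap.adjoint_inner_right]
      rfl
    · rintro ⟨ξ, η, rfl⟩
      refine ⟨ξ, η, ?_⟩
      intro ζ ζ'
      rw [s.a_apply, ContinuousLinearMap.adjoint_inner_right]
      rfl
  have hA : legA t2 W = (s.A : Set (H →L[ℂ] H)) := by
    unfold legA cspan
    rw [hgen]
    rfl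
  have hSgsymm : ∀ u v : H2, ⟪u, Sg v⟫_ℂ = ⟪Sg u, v⟫_ℂ := by
    intro u v
    rw [← ContinuousLinearMap.adjoint_inner_right]
    congr 1
    have : Sg = adjoint Sg := by
      apply t2.ext_of
      intro a b
      apply eq_of_inner_dense t2.dense_span
      rintro _ ⟨c, d, rfl⟩
      rw [ContinuousLinearMap.adjoint_inner_right, hSg, hSg, t2.inner_tmul, t2.inner_tmul,
        mul_comm]
    exact congrArg (fun f => f v) this
  have hsm : s.Semi := by
    intro x y
    have hc : IsCompactOperator ((innerSL ℂ y).smulRight x : H →L[ℂ] H) :=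
      isCompact_rank x y
    have h1 := hsemi hc
    have h2 : slicesR t2 t2 (Sg * W) ⊆
        {T : H →L[ℂ] H | ∃ ξ η, T = adjoint (s.L ξ) ∘L s.W ∘L s.L.flip η} := by
      rintro T ⟨ξ, η, h⟩
      refine ⟨ξ, η, ?_⟩
      ext v
      apply ext_inner_left ℂ
      intro w
      rw [h, ContinuousLinearMap.mul_apply, hSgsymm, hSg, ContinuousLinearMap.comp_apply,
        ContinuousLinearMap.adjoint_inner_right]
      rfl
    exact closure_mono (Submodule.span_mono h2) h1
  rw [hA]
  refine ⟨s.A_closed, fun a ha b hb => s.A_mul a b ha hb, ?_⟩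
  ext c
  constructor
  · rintro ⟨d, hd, rfl⟩
    exact s.A_adj hsm d hd
  · intro hc
    exact ⟨star c, s.A_adj hsm c hc, star_star c⟩

end
end

section
/- Let W be a regular multiplicative unitary on a complex Hilbert space H. Then [{x·W : x ∈ Â(W) ⊗min K(H)}] = Â(W) ⊗min K(H); in particular W is a multiplier of Â(W) ⊗min K(H). -/
/-!
Common framework: we axiomatize realizations of Hilbert-space tensor products.
A `TensorPair E F EF` realizes the Hilbert tensor product `E ⊗ F` as the Hilbert
space `EF`: it consists of a bilinear map `(a, b) ↦ a ⊗ b` whose image satisfies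
the characteristic inner-product identity and has total (dense) linear span.
Operators such as the leg operators `X₁₂`, `X₂₃`, `X₁₃`, amplifications `a ⊗ b`,
and the tensor flip `Σ` are then uniquely characterized by their matrix
coefficients against elementary tensors.
-/

noncomputable section

open scoped InnerProductSpace
open ContinuousLinearMap

section Helpers

set_option linter.unusedSectionVars false

/-- Induction principle for closed linear spans. -/
theorem cs_ind {V : Type*} [NormedAddCommGroup V] [NormedSpace ℂ V] {S : Set V} {p : V → Prop}
    (hS : ∀ v ∈ S, p v) (h0 : p 0) (hadd : ∀ u v, p u → p v → p (u + v))
    (hsm : ∀ (c : ℂ) v, p v → p (c • v)) (hcl : IsClosed {v | p v}) :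
    ∀ v ∈ cspan S, p v := by
  have h : (Submodule.span ℂ S : Set V) ⊆ {v | p v} := by
    intro v hv
    exact Submodule.span_induction (p := fun v _ => p v) (fun v hv => hS v hv) h0
      (fun u v _ _ hu hv => hadd u v hu hv) (fun c v _ hv => hsm c v hv) hv
  intro v hv
  exact closure_minimal h hcl hv

/-- The closed span as a submodule. -/
def cs {V : Type*} [NormedAddCommGroup V] [NormedSpace ℂ V] (S : Set V) : Submodule ℂ V :=
  (Submodule.span ℂ S).topologicalClosure

theorem mem_cs {V : Type*} [NormedAddCommGroup V] [NormedSpace ℂ V] {S : Set V} {v : V} :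
    v ∈ cs S ↔ v ∈ cspan S := Iff.rfl

theorem cs_closed {V : Type*} [NormedAddCommGroup V] [NormedSpace ℂ V] (S : Set V) :
    IsClosed (cs S : Set V) := Submodule.isClosed_topologicalClosure _

theorem subset_cs {V : Type*} [NormedAddCommGroup V] [NormedSpace ℂ V] {S : Set V} {v : V}
    (h : v ∈ S) : v ∈ cs S := subset_closure (Submodule.subset_span h)

/-- additive, continuous, conj- or linear maps send closed spans into closed submodules -/
theorem cs_map {V V' : Type*} [NormedAddCommGroup V] [NormedSpace ℂ V]
    [NormedAddCommGroup V'] [NormedSpace ℂ V'] {S : Set V} (N : Submodule ℂ V')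
    (hN : IsClosed (N : Set V')) {σ : ℂ →+* ℂ} (f : V →SL[σ] V') (h : ∀ v ∈ S, f v ∈ N) :
    ∀ v ∈ cspan S, f v ∈ N := by
  refine cs_ind h (by simp) (fun u v hu hv => by rw [map_add]; exact N.add_mem hu hv)
    (fun c v hv => by rw [map_smulₛₗ]; exact N.smul_mem _ hv) (hN.preimage f.continuous)

section Pair

variable {E F EF X : Type*}
    [NormedAddCommGroup E] [InnerProductSpace ℂ E]
    [NormedAddCommGroup F] [InnerProductSpace ℂ F]
    [NormedAddCommGroup EF] [InnerProductSpace ℂ EF]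

theorem TensorPair.ext_clm [NormedAddCommGroup X] [NormedSpace ℂ X]
    (t : TensorPair E F EF) {A B : EF →L[ℂ] X}
    (h : ∀ a b, A (t.tmul a b) = B (t.tmul a b)) : A = B := by
  refine ContinuousLinearMap.ext_on t.dense_span ?_
  rintro z ⟨a, b, rfl⟩
  exact h a b

theorem TensorPair.ext_vec (t : TensorPair E F EF) {u v : EF}
    (h : ∀ a b, ⟪t.tmul a b, u⟫_ℂ = ⟪t.tmul a b, v⟫_ℂ) : u = v := by
  have h2 : innerSL ℂ u = innerSL ℂ v := by
    refine t.ext_clm fun a b => ?_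
    simp only [innerSL_apply_apply]
    rw [← inner_conj_symm, h, inner_conj_symm]
  refine ext_inner_right ℂ fun w => ?_
  have := congrArg (fun f => f w) h2
  simpa using this

open scoped TensorProduct in
theorem norm_lift_eq [NormedAddCommGroup X] [InnerProductSpace ℂ X]
    (f : E →ₗ[ℂ] F →ₗ[ℂ] X) (r : ℝ) (hr : 0 ≤ r)
    (hf : ∀ a b c d, ⟪f a b, f c d⟫_ℂ = (r : ℂ) ^ 2 * (⟪a, c⟫_ℂ * ⟪b, d⟫_ℂ)) (z : E ⊗[ℂ] F) :
    ‖TensorProduct.lift f z‖ = r * ‖z‖ := by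
  have h : ∀ z w : E ⊗[ℂ] F, ⟪TensorProduct.lift f z, TensorProduct.lift f w⟫_ℂ
      = (r : ℂ) ^ 2 * ⟪z, w⟫_ℂ := by
    intro z w
    induction z with
    | zero => simp
    | add x y hx hy => rw [map_add, inner_add_left, inner_add_left, hx, hy, mul_add]
    | tmul a b =>
      induction w with
      | zero => simp
      | add x y hx hy => rw [map_add, inner_add_right, inner_add_right, hx, hy, mul_add]
      | tmul c d => simp [hf]
  have h1 := h z z
  have h3 : ⟪z, z⟫_ℂ = (‖z‖ : ℂ) ^ 2 := inner_self_eq_norm_sq_to_K (𝕜 := ℂ) z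
  have h4 : ⟪TensorProduct.lift f z, TensorProduct.lift f z⟫_ℂ =
    (‖TensorProduct.lift f z‖ : ℂ) ^ 2 := inner_self_eq_norm_sq_to_K (𝕜 := ℂ) _
  rw [h4, h3] at h1
  have h2 : ‖TensorProduct.lift f z‖ ^ 2 = (r * ‖z‖) ^ 2 := by
    rw [mul_pow]; exact_mod_cast h1
  exact (pow_left_inj₀ (norm_nonneg _) (by positivity) two_ne_zero).1 h2

open scoped TensorProduct in
theorem TensorPair.norm_lift (t : TensorPair E F EF) (z : E ⊗[ℂ] F) :
    ‖TensorProduct.lift t.tmul z‖ = ‖z‖ := by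
  have := norm_lift_eq t.tmul 1 zero_le_one (by simp [t.inner_tmul]) z
  simpa using this

theorem TensorPair.denseRange (t : TensorPair E F EF) :
    DenseRange (TensorProduct.lift t.tmul) := by
  refine t.dense_span.mono ?_
  have : Submodule.span ℂ {z : EF | ∃ a b, z = t.tmul a b}
      ≤ LinearMap.range (TensorProduct.lift t.tmul) := by
    rw [Submodule.span_le]
    rintro z ⟨a, b, rfl⟩
    exact ⟨a ⊗ₜ b, by simp⟩
  exact this

open scoped TensorProduct in
theorem TensorPair.exists_ext_s6 [NormedAddCommGroup X] [NormedSpace ℂ X] [CompleteSpace X]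
    (t : TensorPair E F EF) (g : E ⊗[ℂ] F →ₗ[ℂ] X) (r : ℝ) (hr : 0 ≤ r)
    (hg : ∀ z, ‖g z‖ ≤ r * ‖z‖) :
    ∃ G : EF →L[ℂ] X, (∀ a b, G (t.tmul a b) = g (a ⊗ₜ b)) ∧ ‖G‖ ≤ r := by
  have hb : ∀ z, ‖g z‖ ≤ r * ‖TensorProduct.lift t.tmul z‖ := fun z => by
    rw [t.norm_lift]; exact hg z
  refine ⟨g.extendOfNorm (TensorProduct.lift t.tmul), fun a b => ?_,
    LinearMap.opNorm_extendOfNorm_le t.denseRange hr hb⟩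
  have := LinearMap.extendOfNorm_eq t.denseRange ⟨r, hb⟩ (a ⊗ₜ b)
  simpa using this

theorem TensorPair.exists_iso [NormedAddCommGroup X] [InnerProductSpace ℂ X] [CompleteSpace X]
    (t : TensorPair E F EF) (f : E →ₗ[ℂ] F →ₗ[ℂ] X) (r : ℝ) (hr : 0 ≤ r)
    (hf : ∀ a b c d, ⟪f a b, f c d⟫_ℂ = (r : ℂ) ^ 2 * (⟪a, c⟫_ℂ * ⟪b, d⟫_ℂ)) :
    ∃ G : EF →L[ℂ] X, (∀ a b, G (t.tmul a b) = f a b) ∧ ‖G‖ ≤ r := by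
  obtain ⟨G, hG, hn⟩ := t.exists_ext_s6 (TensorProduct.lift f) r hr
    (fun z => (norm_lift_eq f r hr hf z).le)
  exact ⟨G, by simpa using hG, hn⟩

theorem TensorPair.exists_ampR [CompleteSpace EF] (t : TensorPair E F EF) :
    ∃ A : (F →L[ℂ] F) →L[ℂ] (EF →L[ℂ] EF), ∀ b x y, A b (t.tmul x y) = t.tmul x (b y) := by
  have h : ∀ b : F →L[ℂ] F, ∃ G : EF →L[ℂ] EF,
      (∀ x y, G (t.tmul x y) = t.tmul x (b y)) ∧ ‖G‖ ≤ ‖b‖ := by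
    intro b
    obtain ⟨G, hG, hn⟩ := t.exists_ext_s6
      ((TensorProduct.lift t.tmul).comp (TensorProduct.mapL (1 : E →L[ℂ] E) b).toLinearMap)
      ‖b‖ (norm_nonneg _) (fun z => by
        simp only [LinearMap.comp_apply]
        rw [t.norm_lift]
        refine (ContinuousLinearMap.le_opNorm _ z).trans ?_
        gcongr
        refine (TensorProduct.norm_mapL_le _ _).trans ?_
        calc ‖(1 : E →L[ℂ] E)‖ * ‖b‖ ≤ 1 * ‖b‖ := by
              gcongr; exact ContinuousLinearMap.norm_id_le
          _ = ‖b‖ := one_mul _)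
    exact ⟨G, by simpa using hG, hn⟩
  choose G hG hn using h
  let A : (F →L[ℂ] F) →ₗ[ℂ] (EF →L[ℂ] EF) :=
    { toFun := G
      map_add' := fun b c => t.ext_clm fun x y => by simp [hG]
      map_smul' := fun b c => t.ext_clm fun x y => by simp [hG] }
  exact ⟨A.mkContinuous 1 (fun b => by simpa [A] using hn b), hG⟩

theorem TensorPair.exists_ampL [CompleteSpace EF] (t : TensorPair E F EF) (a : E →L[ℂ] E) :
    ∃ G : EF →L[ℂ] EF, ∀ x y, G (t.tmul x y) = t.tmul (a x) y := by
  obtain ⟨G, hG, hn⟩ := t.exists_ext_s6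
      ((TensorProduct.lift t.tmul).comp (TensorProduct.mapL a (1 : F →L[ℂ] F)).toLinearMap)
      ‖TensorProduct.mapL a (1 : F →L[ℂ] F)‖ (opNorm_nonneg _) (fun z => by
        simp only [LinearMap.comp_apply]
        rw [t.norm_lift]
        exact ContinuousLinearMap.le_opNorm _ z)
  exact ⟨G, by simpa using hG⟩

theorem TensorPair.norm_tmul (t : TensorPair E F EF) (a : E) (b : F) :
    ‖t.tmul a b‖ = ‖a‖ * ‖b‖ := by
  have := t.norm_lift (a ⊗ₜ b)
  simpa using this

/-- `R ξ : ζ ↦ ζ ⊗ ξ`. -/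
def TensorPair.R (t : TensorPair E F EF) (ξ : F) : E →L[ℂ] EF :=
  (t.tmul.flip ξ).mkContinuous ‖ξ‖ (fun a => by simp [t.norm_tmul, mul_comm])

@[simp] theorem TensorPair.R_apply (t : TensorPair E F EF) (ξ : F) (a : E) :
    t.R ξ a = t.tmul a ξ := rfl

theorem TensorPair.R_adj [CompleteSpace E] [CompleteSpace EF] (t : TensorPair E F EF)
    (ξ : F) (a : E) (b : F) :
    ContinuousLinearMap.adjoint (t.R ξ) (t.tmul a b) = ⟪ξ, b⟫_ℂ • a := by
  refine ext_inner_left ℂ fun v => ?_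
  rw [adjoint_inner_right, t.R_apply, t.inner_tmul, inner_smul_right, mul_comm]

end Pair

/-- finite rank operators are dense in the compact ones -/
theorem compact_mem_cspan {H : Type*} [NormedAddCommGroup H] [InnerProductSpace ℂ H]
    [CompleteSpace H] (T : H →L[ℂ] H) (hT : IsCompactOperator T) :
    T ∈ cspan {S : H →L[ℂ] H | ∃ x y, S = InnerProductSpace.rankOne ℂ x y} := by
  rw [cspan, Metric.mem_closure_iff]
  intro ε hε
  have hc := (hT.isCompact_closure_image_closedBall (f := T.toLinearMap) 1)
  have htb := hc.totallyBounded
  rw [Metric.totallyBounded_iff] at htb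
  obtain ⟨s, hs, hcov⟩ := htb (ε / 2) (by positivity)
  let V := Submodule.span ℂ s
  have : FiniteDimensional ℂ V := FiniteDimensional.span_of_finite ℂ hs
  let P := V.starProjection
  refine ⟨P * T, ?_, ?_⟩
  · let b := stdOrthonormalBasis ℂ V
    have : P * T = ∑ i, InnerProductSpace.rankOne ℂ (b i : H)
        (ContinuousLinearMap.adjoint T (b i : H)) := by
      have h := b.starProjection_eq_sum_rankOne
      change V.starProjection * T = _
      rw [h, Finset.sum_mul]
      refine Finset.sum_congr rfl fun i _ => ?_
      ext v
      simp [adjoint_inner_left]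
    rw [this]
    exact Submodule.sum_mem _ fun i _ => Submodule.subset_span ⟨_, _, rfl⟩
  · rw [dist_eq_norm]
    refine lt_of_le_of_lt (ContinuousLinearMap.opNorm_le_of_unit_norm (C := ε / 2) (by positivity)
      ?_) (by linarith)
    intro x hx
    have hx' : T x ∈ closure (T.toLinearMap '' Metric.closedBall 0 1) :=
      subset_closure ⟨x, by simp [hx], rfl⟩
    have := hcov hx'
    simp only [Set.mem_iUnion] at this
    obtain ⟨y, hy, hxy⟩ := this
    have hyV : y ∈ V := Submodule.subset_span hy
    have h1 := Submodule.starProjection_minimal (U := V) (T x)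
    have h2 : ‖T x - P (T x)‖ ≤ ‖T x - y‖ := by
      change ‖T x - V.starProjection (T x)‖ ≤ _
      rw [h1]
      exact ciInf_le ⟨0, by rintro _ ⟨w, rfl⟩; exact norm_nonneg _⟩ (⟨y, hyV⟩ : V)
    rw [Metric.mem_ball, dist_eq_norm] at hxy
    simpa using h2.trans hxy.le

section Two

variable {H H2 : Type*}
    [NormedAddCommGroup H] [InnerProductSpace ℂ H] [CompleteSpace H]
    [NormedAddCommGroup H2] [InnerProductSpace ℂ H2] [CompleteSpace H2]

/-- `E x y = 1 ⊗ |x⟩⟨y|`. -/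
def TensorPair.E (t : TensorPair H H H2) (x y : H) : H2 →L[ℂ] H2 :=
  t.R x ∘L ContinuousLinearMap.adjoint (t.R y)

theorem TensorPair.E_tmul (t : TensorPair H H H2) (x y a b : H) :
    t.E x y (t.tmul a b) = ⟪y, b⟫_ℂ • t.tmul a x := by
  simp [TensorPair.E, t.R_adj]

theorem TensorPair.E_mul (t : TensorPair H H H2) (x y z w : H) :
    t.E x y * t.E z w = ⟪y, z⟫_ℂ • t.E x w := by
  refine t.ext_clm fun a b => ?_
  simp [t.E_tmul, smul_smul, mul_comm]

theorem TensorPair.star_E (t : TensorPair H H H2) (x y : H) :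
    star (t.E x y) = t.E y x := by
  rw [star_eq_adjoint, TensorPair.E, adjoint_comp, adjoint_adjoint, TensorPair.E]

theorem TensorPair.E_zero (t : TensorPair H H H2) (x : H) : t.E x 0 = 0 := by
  refine t.ext_clm fun a b => ?_
  simp [t.E_tmul]

/-- generators -/
def gen (t : TensorPair H H H2) (W : H2 →L[ℂ] H2) : Set (H2 →L[ℂ] H2) :=
  {T | ∃ x ξ η y, T = t.E x ξ * W * t.E η y}

/-- right multiplication as a continuous linear map -/
def rmul (B : H2 →L[ℂ] H2) : (H2 →L[ℂ] H2) →L[ℂ] (H2 →L[ℂ] H2) :=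
  (ContinuousLinearMap.mul ℂ (H2 →L[ℂ] H2)).flip B

@[simp] theorem rmul_apply (A B : H2 →L[ℂ] H2) : rmul B A = A * B := rfl

theorem lemC (t : TensorPair H H H2) (W : H2 →L[ℂ] H2) (hWu : star W * W = 1 ∧ W * star W = 1)
    (hS : ∀ z ∈ cs (gen t W), z * W ∈ cs (gen t W))
    (hN : ∀ z ∈ cs (gen t W), z ∈ cs {T | ∃ g ∈ gen t W, T = g * W}) :
    ∀ z ∈ cs (gen t W), W * z ∈ cs (gen t W) := by
  have h1 : ∀ z ∈ cs (gen t W), z * star W ∈ cs (gen t W) := by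
    intro z hz
    refine cs_map (cs (gen t W)) (cs_closed _) (rmul (star W)) ?_ z (hN z hz)
    rintro _ ⟨g, hg, rfl⟩
    rw [rmul_apply, mul_assoc, hWu.2, mul_one]
    exact subset_cs hg
  let G1 : Set (H2 →L[ℂ] H2) :=
    {T | ∃ x ξ η y p q, T = t.E x ξ * W * t.E η y * star W * t.E p q}
  have hSE : ∀ p q, ∀ z ∈ cs (gen t W), z * t.E p q ∈ cs (gen t W) := by
    intro p q z hz
    refine cs_map (cs (gen t W)) (cs_closed _) (rmul (t.E p q)) ?_ z hz
    rintro _ ⟨x, ξ, η, y, rfl⟩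
    rw [rmul_apply, mul_assoc, t.E_mul, mul_smul_comm]
    exact Submodule.smul_mem _ _ (subset_cs ⟨_, _, _, _, rfl⟩)
  have h10 : ∀ z ∈ cs G1, z ∈ cs (gen t W) := by
    intro z hz
    refine cs_map (cs (gen t W)) (cs_closed _) (.id ℂ _) ?_ z hz
    rintro _ ⟨x, ξ, η, y, p, q, rfl⟩
    exact hSE _ _ _ (h1 _ (subset_cs ⟨_, _, _, _, rfl⟩))
  have h01 : ∀ z ∈ cs (gen t W), z ∈ cs G1 := by
    intro z hz
    refine cs_map (cs G1) (cs_closed _) (.id ℂ _) ?_ z hz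
    rintro _ ⟨x, ξ, η, y, rfl⟩
    rw [ContinuousLinearMap.id_apply]
    by_cases hy : y = 0
    · rw [hy, t.E_zero, mul_zero]; exact Submodule.zero_mem _
    have h2 : ∀ w ∈ cs (gen t W), w * (star W * t.E y y) ∈ cs G1 := by
      intro w hw
      refine cs_map (cs G1) (cs_closed _) (rmul (star W * t.E y y)) ?_ w hw
      rintro _ ⟨x, ξ, η, y', rfl⟩
      rw [rmul_apply, ← mul_assoc]
      exact subset_cs ⟨_, _, _, _, _, _, rfl⟩
    have h3 := h2 _ (hS _ (subset_cs ⟨x, ξ, η, y, rfl⟩))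
    rw [mul_assoc _ W, ← mul_assoc W, hWu.2, one_mul, mul_assoc, t.E_mul, mul_smul_comm] at h3
    have hne : ⟪y, y⟫_ℂ ≠ 0 := inner_self_ne_zero.2 hy
    have := Submodule.smul_mem _ (⟪y, y⟫_ℂ)⁻¹ h3
    rwa [smul_smul, inv_mul_cancel₀ hne, one_smul] at this
  have hst : ∀ z ∈ cs (gen t W), star z ∈ cs (gen t W) := by
    intro z hz
    apply h10
    refine cs_map (cs G1) (cs_closed _)
      (ContinuousLinearMap.adjoint (𝕜 := ℂ) (E := H2) (F := H2)).toContinuousLinearEquiv.toContinuousLinearMap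
      ?_ z (h01 z hz)
    rintro _ ⟨x, ξ, η, y, p, q, rfl⟩
    refine subset_cs ⟨q, p, y, η, ξ, x, ?_⟩
    change star _ = _
    simp only [star_mul, t.star_E, star_star, mul_assoc]
  intro z hz
  have := hst _ (h1 _ (hst z hz))
  rwa [star_mul, star_star, star_star] at this

theorem slice_eq (t : TensorPair H H H2) (X : H2 →L[ℂ] H2) (a : H →L[ℂ] H) (ξ η : H)
    (h : ∀ ζ ζ', ⟪ζ, a ζ'⟫_ℂ = ⟪t.tmul ζ ξ, X (t.tmul ζ' η)⟫_ℂ) :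
    a = ContinuousLinearMap.adjoint (t.R ξ) ∘L X ∘L t.R η := by
  ext v
  refine ext_inner_left ℂ fun w => ?_
  rw [h]
  simp [adjoint_inner_right]

theorem slice_mem (t : TensorPair H H H2) (X : H2 →L[ℂ] H2) (ξ η : H) :
    ContinuousLinearMap.adjoint (t.R ξ) ∘L X ∘L t.R η ∈ slicesR t t X :=
  ⟨ξ, η, fun ζ ζ' => by simp [adjoint_inner_right]⟩

theorem rankOne_compact (x y : H) :
    IsCompactOperator (InnerProductSpace.rankOne ℂ x y : H →L[ℂ] H) := by
  rw [InnerProductSpace.rankOne_def']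
  exact (isCompactOperator_of_locallyCompactSpace_rng (ContinuousLinearMap.toSpanSingleton ℂ x)).comp_clm
    (innerSL ℂ y)

/-- sandwich map -/
def sandwich (P : H →L[ℂ] H2) (Q : H2 →L[ℂ] H) : (H →L[ℂ] H) →L[ℂ] (H2 →L[ℂ] H2) :=
  (compL ℂ H2 H H2 P) ∘L ((compL ℂ H2 H H).flip Q)

@[simp] theorem sandwich_apply (P : H →L[ℂ] H2) (Q : H2 →L[ℂ] H) (a : H →L[ℂ] H) :
    sandwich P Q a = P ∘L a ∘L Q := rfl

theorem minTensor_eq (t : TensorPair H H H2) (W : H2 →L[ℂ] H2) :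
    minTensor t (hatA t W) {T : H →L[ℂ] H | IsCompactOperator T} = cspan (gen t W) := by
  apply Set.Subset.antisymm
  · intro z hz
    refine cs_map (cs (gen t W)) (cs_closed _) (.id ℂ _) ?_ z hz
    rintro T ⟨a, ha, b, hb, hT⟩
    rw [ContinuousLinearMap.id_apply]
    obtain ⟨A, hA⟩ := t.exists_ampR
    obtain ⟨aL, haL⟩ := t.exists_ampL a
    have hTe : T = aL * A b := by
      refine t.ext_clm fun x y => t.ext_vec fun x' y' => ?_
      rw [hT]
      simp [hA, haL, t.inner_tmul]
    rw [hTe]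
    refine cs_map (cs (gen t W)) (cs_closed _)
      ((ContinuousLinearMap.mul ℂ (H2 →L[ℂ] H2) aL) ∘L A) ?_ b (compact_mem_cspan b hb)
    rintro _ ⟨x, y, rfl⟩
    have h1 : ((ContinuousLinearMap.mul ℂ (H2 →L[ℂ] H2) aL) ∘L A)
        (InnerProductSpace.rankOne ℂ x y)
        = sandwich (t.R x) (ContinuousLinearMap.adjoint (t.R y)) a := by
      refine t.ext_clm fun u v => ?_
      simp [hA, haL, t.R_adj]
    rw [h1]
    refine cs_map (cs (gen t W)) (cs_closed _) _ ?_ a ha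
    rintro a ⟨ξ, η, h⟩
    rw [slice_eq t W a ξ η h]
    exact subset_cs ⟨x, ξ, η, y, rfl⟩
  · intro z hz
    refine cs_map (cs _) (cs_closed _) (.id ℂ _) ?_ z hz
    rintro _ ⟨x, ξ, η, y, rfl⟩
    refine subset_cs ⟨_, subset_cs (slice_mem t W ξ η), _, rankOne_compact x y, ?_⟩
    intro ζ ξ' ζ' η'
    have : t.E x ξ * W * t.E η y = sandwich (t.R x) (ContinuousLinearMap.adjoint (t.R y))
      (ContinuousLinearMap.adjoint (t.R ξ) ∘L W ∘L t.R η) := rfl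
    rw [this]
    simp [t.R_adj, t.inner_tmul]
    ring

end Two

section Three

variable {H H2 H3 : Type*}
    [NormedAddCommGroup H] [InnerProductSpace ℂ H] [CompleteSpace H]
    [NormedAddCommGroup H2] [InnerProductSpace ℂ H2] [CompleteSpace H2]
    [NormedAddCommGroup H3] [InnerProductSpace ℂ H3] [CompleteSpace H3]

theorem t3_ext_clm {X : Type*} [NormedAddCommGroup X] [NormedSpace ℂ X]
    (t : TensorTriple H H H H3) {A B : H3 →L[ℂ] X}
    (h : ∀ a b c, A (t.tmul a b c) = B (t.tmul a b c)) : A = B := by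
  refine ContinuousLinearMap.ext_on t.dense_span ?_
  rintro z ⟨a, b, c, rfl⟩
  exact h a b c

theorem t3_ext_vec (t : TensorTriple H H H H3) {u v : H3}
    (h : ∀ a b c, ⟪t.tmul a b c, u⟫_ℂ = ⟪t.tmul a b c, v⟫_ℂ) : u = v := by
  have h2 : innerSL ℂ u = innerSL ℂ v := by
    refine t3_ext_clm t fun a b c => ?_
    simp only [innerSL_apply_apply]
    rw [← inner_conj_symm, h, inner_conj_symm]
  refine ext_inner_right ℂ fun w => ?_
  have := congrArg (fun f => f w) h2
  simpa using this

theorem exists_R3 (t2 : TensorPair H H H2) (t3 : TensorTriple H H H H3) (β : H) :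
    ∃ G : H2 →L[ℂ] H3, ∀ a b, G (t2.tmul a b) = t3.tmul a b β := by
  obtain ⟨G, hG, -⟩ := t2.exists_iso (t3.tmul.compr₂ (LinearMap.applyₗ β)) ‖β‖ (norm_nonneg _)
    (fun a b c d => by
      have : ⟪β, β⟫_ℂ = (‖β‖ : ℂ) ^ 2 := inner_self_eq_norm_sq_to_K (𝕜 := ℂ) β
      simp only [LinearMap.compr₂_apply, LinearMap.applyₗ_apply_apply, t3.inner_tmul, this]
      ring)
  exact ⟨G, hG⟩

theorem exists_M3 (t2 : TensorPair H H H2) (t3 : TensorTriple H H H H3) (α : H) :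
    ∃ G : H2 →L[ℂ] H3, ∀ a c, G (t2.tmul a c) = t3.tmul a α c := by
  obtain ⟨G, hG, -⟩ := t2.exists_iso (t3.tmul.flip α) ‖α‖ (norm_nonneg _)
    (fun a b c d => by
      have : ⟪α, α⟫_ℂ = (‖α‖ : ℂ) ^ 2 := inner_self_eq_norm_sq_to_K (𝕜 := ℂ) α
      simp only [LinearMap.flip_apply, t3.inner_tmul, this]
      ring)
  exact ⟨G, hG⟩

theorem exists_K3 (t2 : TensorPair H H H2) (t3 : TensorTriple H H H H3) :
    ∃ K : H →L[ℂ] H2 →L[ℂ] H3, ∀ a b c, K a (t2.tmul b c) = t3.tmul a b c := by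
  have h : ∀ a : H, ∃ G : H2 →L[ℂ] H3, (∀ b c, G (t2.tmul b c) = t3.tmul a b c) ∧ ‖G‖ ≤ ‖a‖ := by
    intro a
    exact t2.exists_iso (t3.tmul a) ‖a‖ (norm_nonneg _)
      (fun x b c d => by
        have : ⟪a, a⟫_ℂ = (‖a‖ : ℂ) ^ 2 := inner_self_eq_norm_sq_to_K (𝕜 := ℂ) a
        simp only [t3.inner_tmul, this]
        ring)
  choose G hG hn using h
  let A : H →ₗ[ℂ] (H2 →L[ℂ] H3) :=
    { toFun := G
      map_add' := fun b c => t2.ext_clm fun x y => by simp [hG]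
      map_smul' := fun b c => t2.ext_clm fun x y => by simp [hG] }
  exact ⟨A.mkContinuous 1 (fun b => by simpa [A] using hn b), hG⟩

theorem leg23_K (t2 : TensorPair H H H2) (t3 : TensorTriple H H H H3)
    (K : H →L[ℂ] H2 →L[ℂ] H3) (hK : ∀ a b c, K a (t2.tmul b c) = t3.tmul a b c)
    (W : H2 →L[ℂ] H2) (W23 : H3 →L[ℂ] H3) (hW23 : IsLeg23 t2 t3 W W23) (a : H) :
    W23 ∘L K a = K a ∘L W := by
  have hKa : ∀ a' b' c', ContinuousLinearMap.adjoint (K a) (t3.tmul a' b' c')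
      = ⟪a, a'⟫_ℂ • t2.tmul b' c' := by
    intro a' b' c'
    refine t2.ext_vec fun b c => ?_
    rw [adjoint_inner_right, hK, t3.inner_tmul, inner_smul_right, t2.inner_tmul]
    ring
  refine t2.ext_clm fun b c => t3_ext_vec t3 fun a' b' c' => ?_
  simp only [ContinuousLinearMap.comp_apply]
  rw [hK, hW23, ← adjoint_inner_left (K a), hKa, inner_smul_left, inner_conj_symm]
  ring

theorem leg23_isom (t2 : TensorPair H H H2) (t3 : TensorTriple H H H H3)
    (W : H2 →L[ℂ] H2) (hW : star W * W = 1)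
    (W23 : H3 →L[ℂ] H3) (hW23 : IsLeg23 t2 t3 W W23) : star W23 * W23 = 1 := by
  obtain ⟨K, hK⟩ := exists_K3 t2 t3
  have h := leg23_K t2 t3 K hK W W23 hW23
  have hKK : ∀ a a', ContinuousLinearMap.adjoint (K a) ∘L K a' = ⟪a, a'⟫_ℂ • 1 := by
    intro a a'
    refine t2.ext_clm fun b c => t2.ext_vec fun b' c' => ?_
    simp only [ContinuousLinearMap.comp_apply]
    rw [adjoint_inner_right, hK, hK, t3.inner_tmul]
    simp [t2.inner_tmul, mul_assoc]
  refine t3_ext_clm t3 fun a b c => t3_ext_vec t3 fun a' b' c' => ?_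
  have e : ∀ a b c, W23 (t3.tmul a b c) = K a (W (t2.tmul b c)) := by
    intro a b c
    rw [← hK]
    exact congrArg (fun f => f (t2.tmul b c)) (h a)
  have e2 : ∀ v, ContinuousLinearMap.adjoint (K a') (K a v) = ⟪a', a⟫_ℂ • v := by
    intro v
    exact congrArg (fun f => f v) (hKK a' a)
  have e3 : ∀ v, ContinuousLinearMap.adjoint W (W v) = v := by
    intro v
    exact congrArg (fun f => f v) hW
  rw [mul_apply_eq_comp, star_eq_adjoint, adjoint_inner_right, e, e, ← adjoint_inner_right, e2,
    inner_smul_right, ← adjoint_inner_right, e3]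
  simp [t2.inner_tmul, t3.inner_tmul, mul_assoc]

theorem leg23_star (t2 : TensorPair H H H2) (t3 : TensorTriple H H H H3)
    (W : H2 →L[ℂ] H2) (W23 : H3 →L[ℂ] H3) (hW23 : IsLeg23 t2 t3 W W23) :
    IsLeg23 t2 t3 (star W) (star W23) := by
  intro a a' b b' c c'
  rw [star_eq_adjoint, star_eq_adjoint, adjoint_inner_right, adjoint_inner_right,
    ← inner_conj_symm, hW23, map_mul, inner_conj_symm, inner_conj_symm]

/-- The key identity `(1 ⊗ ⟨ξ|) W (1 ⊗ k) = J(W(ξ ⊗ β))* W₁₂ M_α W`. -/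
theorem key_identity
    (t2 : TensorPair H H H2) (t3 : TensorTriple H H H H3)
    (W : H2 →L[ℂ] H2) (hWu : star W * W = 1 ∧ W * star W = 1)
    (W12 W23 W13 : H3 →L[ℂ] H3)
    (hW12 : IsLeg12 t2 t3 W W12) (hW23 : IsLeg23 t2 t3 W W23)
    (hW13 : IsLeg13 t2 t3 W W13)
    (hpent : W23 * W12 = W12 * W13 * W23)
    (K : H →L[ℂ] H2 →L[ℂ] H3) (hK : ∀ a b c, K a (t2.tmul b c) = t3.tmul a b c)
    (A : (H →L[ℂ] H) →L[ℂ] (H2 →L[ℂ] H2)) (hA : ∀ b x y, A b (t2.tmul x y) = t2.tmul x (b y))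
    (α : H) (M : H2 →L[ℂ] H3) (hM : ∀ a c, M (t2.tmul a c) = t3.tmul a α c)
    (β : H) (T : H →L[ℂ] H)
    (hT : ∀ ζ ζ', ⟪ζ, T ζ'⟫_ℂ = ⟪t2.tmul α ζ, W (t2.tmul ζ' β)⟫_ℂ) (ξ : H) :
    ContinuousLinearMap.adjoint (t2.R ξ) ∘L W ∘L A (ContinuousLinearMap.adjoint T) =
      ContinuousLinearMap.adjoint (K.flip (W (t2.tmul ξ β))) ∘L W12 ∘L M ∘L W := by
  obtain ⟨R3, hR3⟩ := exists_R3 t2 t3 β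
  have hR3a : ∀ a b c, ContinuousLinearMap.adjoint R3 (t3.tmul a b c) = ⟪β, c⟫_ℂ • t2.tmul a b := by
    intro a b c
    refine t2.ext_vec fun a' b' => ?_
    rw [adjoint_inner_right, hR3, t3.inner_tmul, inner_smul_right, t2.inner_tmul]
    ring
  have hMa : ∀ a b c, ContinuousLinearMap.adjoint M (t3.tmul a b c) = ⟪α, b⟫_ℂ • t2.tmul a c := by
    intro a b c
    refine t2.ext_vec fun a' b' => ?_
    rw [adjoint_inner_right, hM, t3.inner_tmul, inner_smul_right, t2.inner_tmul]
    ring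
  have e1 : A (ContinuousLinearMap.adjoint T) = ContinuousLinearMap.adjoint R3 ∘L star W23 ∘L M := by
    refine t2.ext_clm fun a c => t2.ext_vec fun a' b' => ?_
    simp only [ContinuousLinearMap.comp_apply]
    rw [hA, adjoint_inner_right, hR3, star_eq_adjoint, adjoint_inner_right, hM, t2.inner_tmul,
      adjoint_inner_right, ← inner_conj_symm (W23 _), hW23, ← hT, map_mul, inner_conj_symm,
      inner_conj_symm, mul_comm]
  have e2 : W ∘L ContinuousLinearMap.adjoint R3 = ContinuousLinearMap.adjoint R3 ∘L W12 := by
    refine t3_ext_clm t3 fun a b c => t2.ext_vec fun a' b' => ?_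
    simp only [ContinuousLinearMap.comp_apply]
    rw [adjoint_inner_right, hR3, hW12, hR3a, map_smul, inner_smul_right, mul_comm]
  have e3 : W13 ∘L M = M ∘L W := by
    refine t2.ext_clm fun a c => t3_ext_vec t3 fun a' b' c' => ?_
    simp only [ContinuousLinearMap.comp_apply]
    rw [hM, hW13, ← adjoint_inner_left M, hMa, inner_smul_left, inner_conj_symm, mul_comm]
  have u1 : star W23 * W23 = 1 := leg23_isom t2 t3 W hWu.1 W23 hW23
  have u2 : W23 * star W23 = 1 := by
    have := leg23_isom t2 t3 (star W) (by rw [star_star]; exact hWu.2) _ (leg23_star t2 t3 W W23 hW23)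
    rwa [star_star] at this
  have e4 : W12 * star W23 = star W23 * W12 * W13 := by
    calc W12 * star W23 = star W23 * (W23 * W12) * star W23 := by
          rw [← mul_assoc (star W23), u1, one_mul]
      _ = star W23 * W12 * W13 * (W23 * star W23) := by rw [hpent]; simp only [mul_assoc]
      _ = _ := by rw [u2, mul_one]
  have e5 : ContinuousLinearMap.adjoint (t2.R ξ) ∘L ContinuousLinearMap.adjoint R3
      = ContinuousLinearMap.adjoint (K.flip (t2.tmul ξ β)) := by
    rw [← adjoint_comp]
    congr 1
    ext a
    simp [hR3, hK]
  have e6 : ContinuousLinearMap.adjoint (K.flip (W (t2.tmul ξ β)))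
      = ContinuousLinearMap.adjoint (K.flip (t2.tmul ξ β)) ∘L star W23 := by
    rw [star_eq_adjoint, ← adjoint_comp]
    congr 1
    ext a
    have := congrArg (fun f => f (t2.tmul ξ β)) (leg23_K t2 t3 K hK W W23 hW23 a)
    simpa using this.symm
  rw [e6, ← e3, ← e5, e1]
  calc _ = ContinuousLinearMap.adjoint (t2.R ξ) ∘L (W ∘L ContinuousLinearMap.adjoint R3) ∘L
        star W23 ∘L M := rfl
    _ = ContinuousLinearMap.adjoint (t2.R ξ) ∘L ContinuousLinearMap.adjoint R3 ∘L
        (W12 * star W23) ∘L M := by rw [e2]; rfl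
    _ = _ := by rw [e4]; rfl

/-- adjoint as a continuous conjugate-linear map -/
def adjCLM (X Y : Type*) [NormedAddCommGroup X] [InnerProductSpace ℂ X] [CompleteSpace X]
    [NormedAddCommGroup Y] [InnerProductSpace ℂ Y] [CompleteSpace Y] :
    (X →L[ℂ] Y) →L⋆[ℂ] (Y →L[ℂ] X) :=
  (ContinuousLinearMap.adjoint (𝕜 := ℂ) (E := X) (F := Y)).toContinuousLinearEquiv.toContinuousLinearMap

@[simp] theorem adjCLM_apply (X Y : Type*)
    [NormedAddCommGroup X] [InnerProductSpace ℂ X] [CompleteSpace X]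
    [NormedAddCommGroup Y] [InnerProductSpace ℂ Y] [CompleteSpace Y] (T : X →L[ℂ] Y) :
    adjCLM X Y T = ContinuousLinearMap.adjoint T := rfl

theorem lemB
    (t2 : TensorPair H H H2) (t3 : TensorTriple H H H H3)
    (W : H2 →L[ℂ] H2) (hWu : star W * W = 1 ∧ W * star W = 1)
    (W12 W23 W13 : H3 →L[ℂ] H3)
    (hW12 : IsLeg12 t2 t3 W W12) (hW23 : IsLeg23 t2 t3 W W23)
    (hW13 : IsLeg13 t2 t3 W W13)
    (hpent : W23 * W12 = W12 * W13 * W23)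
    (Sg : H2 →L[ℂ] H2) (hSg : ∀ a b : H, Sg (t2.tmul a b) = t2.tmul b a)
    (hreg : hatA t2 (Sg * W) = {T : H →L[ℂ] H | IsCompactOperator T}) :
    (∀ z ∈ cs (gen t2 W), z * W ∈ cs (gen t2 W)) ∧
    (∀ z ∈ cs (gen t2 W), z ∈ cs {T | ∃ g ∈ gen t2 W, T = g * W}) := by
  obtain ⟨K, hK⟩ := exists_K3 t2 t3
  obtain ⟨A, hA⟩ := t2.exists_ampR
  choose M hM using exists_M3 t2 t3
  have hSgi : ∀ a b v, ⟪t2.tmul a b, Sg v⟫_ℂ = ⟪t2.tmul b a, v⟫_ℂ := by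
    intro a b v
    have : innerSL ℂ (t2.tmul a b) ∘L Sg = innerSL ℂ (t2.tmul b a) := by
      refine t2.ext_clm fun c d => ?_
      simp [hSg, t2.inner_tmul, mul_comm]
    exact congrArg (fun f => f v) this
  have hAr : ∀ x y, A (InnerProductSpace.rankOne ℂ x y) = t2.E x y := by
    intro x y
    refine t2.ext_clm fun a b => ?_
    simp [hA, t2.E_tmul]
  -- the map `P`
  let P : H → H → (H →L[ℂ] H) →L⋆[ℂ] (H2 →L[ℂ] H2) := fun x ξ =>
    (ContinuousLinearMap.mul ℂ (H2 →L[ℂ] H2) (t2.E x ξ * W)) ∘SL A ∘SL adjCLM H H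
  have hP : ∀ x ξ T, P x ξ T = t2.E x ξ * W * A (ContinuousLinearMap.adjoint T) :=
    fun _ _ _ => rfl
  have hPr : ∀ x ξ p q, P x ξ (InnerProductSpace.rankOne ℂ p q) = t2.E x ξ * W * t2.E q p := by
    intro x ξ p q
    rw [hP, InnerProductSpace.adjoint_rankOne, hAr]
  -- the map `F`
  let F : H → H → H2 →L⋆[ℂ] (H2 →L[ℂ] H2) := fun x α =>
    (compL ℂ H2 H H2 (t2.R x)) ∘SL ((compL ℂ H2 H3 H).flip (W12 ∘L M α ∘L W)) ∘SL
      adjCLM H H3 ∘SL K.flip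
  have hF : ∀ x α u, F x α u = t2.R x ∘L ContinuousLinearMap.adjoint (K.flip u) ∘L
      (W12 ∘L M α ∘L W) := fun _ _ _ => rfl
  have fact1 : ∀ x ξ α β T,
      (∀ ζ ζ', ⟪ζ, T ζ'⟫_ℂ = ⟪t2.tmul ζ α, (Sg * W) (t2.tmul ζ' β)⟫_ℂ) →
      P x ξ T = F x α (W (t2.tmul ξ β)) := by
    intro x ξ α β T hT
    rw [hF, ← key_identity t2 t3 W hWu W12 W23 W13 hW12 hW23 hW13 hpent K hK A hA α (M α) (hM α)
      β T (fun ζ ζ' => by rw [hT, mul_apply_eq_comp, hSgi]) ξ]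
    rfl
  have fact2 : ∀ x α c d, F x α (t2.tmul c d) = t2.E x c * W * t2.E α d * W := by
    intro x α c d
    have : ContinuousLinearMap.adjoint (K.flip (t2.tmul c d)) ∘L W12 ∘L M α
        = ContinuousLinearMap.adjoint (t2.R c) ∘L W ∘L t2.E α d := by
      refine t2.ext_clm fun a b => ext_inner_left ℂ fun v => ?_
      simp only [ContinuousLinearMap.comp_apply]
      rw [adjoint_inner_right, adjoint_inner_right, ContinuousLinearMap.flip_apply, hK, hM, hW12,
        t2.E_tmul, map_smul, inner_smul_right, t2.R_apply, mul_comm]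
    calc F x α (t2.tmul c d) = t2.R x ∘L (ContinuousLinearMap.adjoint (K.flip (t2.tmul c d)) ∘L
          W12 ∘L M α) ∘L W := rfl
      _ = _ := by rw [this]; rfl
  have hall : ∀ u : H2, u ∈ cspan {z : H2 | ∃ a b, z = t2.tmul a b} := fun u => t2.dense_span u
  constructor
  · intro z hz
    refine cs_map (cs (gen t2 W)) (cs_closed _) (rmul W) ?_ z hz
    rintro _ ⟨x, c, α, d, rfl⟩
    rw [rmul_apply, ← fact2]
    have hall2 : ∀ v, F x α (W v) ∈ cs (gen t2 W) := by
      intro v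
      refine cs_map (cs (gen t2 W)) (cs_closed _) (F x α ∘SL W) ?_ v (hall v)
      rintro _ ⟨ξ, β, rfl⟩
      have hsl := slice_mem t2 (Sg * W) α β
      have hT : ∀ ζ ζ', ⟪ζ, (ContinuousLinearMap.adjoint (t2.R α) ∘L (Sg * W) ∘L t2.R β) ζ'⟫_ℂ
          = ⟪t2.tmul ζ α, (Sg * W) (t2.tmul ζ' β)⟫_ℂ := fun ζ ζ' => by
        simp [adjoint_inner_right]
      rw [ContinuousLinearMap.comp_apply, ← fact1 x ξ α β _ hT]
      have hc : IsCompactOperator (ContinuousLinearMap.adjoint (t2.R α) ∘L (Sg * W) ∘L t2.R β) := by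
        have h1 : (ContinuousLinearMap.adjoint (t2.R α) ∘L (Sg * W) ∘L t2.R β) ∈
          hatA t2 (Sg * W) := subset_cs hsl
        rw [hreg] at h1
        exact h1
      refine cs_map (cs (gen t2 W)) (cs_closed _) (P x ξ) ?_ _ (compact_mem_cspan _ hc)
      rintro _ ⟨p, q, rfl⟩
      rw [hPr]
      exact subset_cs ⟨_, _, _, _, rfl⟩
    have := hall2 (star W (t2.tmul c d))
    rwa [← mul_apply_eq_comp W, hWu.2] at this
  · intro z hz
    refine cs_map (cs _) (cs_closed _) (.id ℂ _) ?_ z hz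
    rintro _ ⟨x, ξ, η, y, rfl⟩
    rw [ContinuousLinearMap.id_apply, ← hPr]
    have hmem : (InnerProductSpace.rankOne ℂ y η : H →L[ℂ] H) ∈ hatA t2 (Sg * W) := by
      rw [hreg]; exact rankOne_compact y η
    refine cs_map (cs _) (cs_closed _) (P x ξ) ?_ _ hmem
    rintro T ⟨α, β, hT⟩
    rw [fact1 x ξ α β T hT]
    refine cs_map (cs _) (cs_closed _) (F x α) ?_ _ (hall _)
    rintro _ ⟨c, d, rfl⟩
    rw [fact2]
    exact subset_cs ⟨_, ⟨_, _, _, _, rfl⟩, rfl⟩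

end Three

end Helpers

/-- For a regular multiplicative unitary `W` on `H` and
`D := Â(W) ⊗min K(H)`, one has `[D·W] = D`; in particular `W` is a multiplier
of `D`. -/
theorem statement6
    {H H2 H3 : Type*}
    [NormedAddCommGroup H] [InnerProductSpace ℂ H] [CompleteSpace H]
    [NormedAddCommGroup H2] [InnerProductSpace ℂ H2] [CompleteSpace H2]
    [NormedAddCommGroup H3] [InnerProductSpace ℂ H3] [CompleteSpace H3]
    -- realizations of the tensor products H ⊗ H and H ⊗ H ⊗ H
    (t2 : TensorPair H H H2) (t3 : TensorTriple H H H H3)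
    -- W is a unitary on H ⊗ H
    (W : H2 →L[ℂ] H2) (hWu : star W * W = 1 ∧ W * star W = 1)
    -- the legs W₁₂, W₂₃, W₁₃ of W on H ⊗ H ⊗ H
    (W12 W23 W13 : H3 →L[ℂ] H3)
    (hW12 : IsLeg12 t2 t3 W W12) (hW23 : IsLeg23 t2 t3 W W23)
    (hW13 : IsLeg13 t2 t3 W W13)
    -- the pentagon equation W₂₃W₁₂ = W₁₂W₁₃W₂₃
    (hpent : W23 * W12 = W12 * W13 * W23)
    -- the tensor flip Σ on H ⊗ H
    (Sg : H2 →L[ℂ] H2) (hSg : ∀ a b : H, Sg (t2.tmul a b) = t2.tmul b a)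
    -- regularity: C(W) = K(H)
    (hreg : hatA t2 (Sg * W) = {T : H →L[ℂ] H | IsCompactOperator T})
    (D : Set (H2 →L[ℂ] H2))
    (hD : D = minTensor t2 (hatA t2 W) {T : H →L[ℂ] H | IsCompactOperator T}) :
    cspan {y : H2 →L[ℂ] H2 | ∃ x ∈ D, y = x * W} = D ∧
    (∀ x ∈ D, x * W ∈ D ∧ W * x ∈ D) := by
  obtain ⟨hS, hN⟩ := lemB t2 t3 W hWu W12 W23 W13 hW12 hW23 hW13 hpent Sg hSg hreg
  have hL := lemC t2 W hWu hS hN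
  rw [minTensor_eq] at hD
  subst hD
  refine ⟨Set.Subset.antisymm ?_ ?_, fun x hx => ⟨hS x hx, hL x hx⟩⟩
  · intro z hz
    refine cs_map (cs (gen t2 W)) (cs_closed _) (.id ℂ _) ?_ z hz
    rintro _ ⟨x, hx, rfl⟩
    exact hS x hx
  · intro z hz
    refine cs_map (cs _) (cs_closed _) (.id ℂ _) ?_ z (hN z hz)
    rintro _ ⟨g, hg, rfl⟩
    exact subset_cs ⟨g, subset_cs hg, rfl⟩

end
end

section
/- Let W be a regular multiplicative unitary on a complex Hilbert space H. Then [(a ⊗ 1)·W·(1 ⊗ k) : a ∈ Â(W), k ∈ K(H)] = Â(W) ⊗min K(H). -/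
/-!
Common framework: we axiomatize realizations of Hilbert-space tensor products.
A `TensorPair E F EF` realizes the Hilbert tensor product `E ⊗ F` as the Hilbert
space `EF`: it consists of a bilinear map `(a, b) ↦ a ⊗ b` whose image satisfies
the characteristic inner-product identity and has total (dense) linear span.
Operators such as the leg operators `X₁₂`, `X₂₃`, `X₁₃`, amplifications `a ⊗ b`,
and the tensor flip `Σ` are then uniquely characterized by their matrix
coefficients against elementary tensors.
-/

noncomputable section

open scoped InnerProductSpace
open ContinuousLinearMap

namespace RegMU

open scoped TensorProduct

section general

variable {V V' : Type*} [NormedAddCommGroup V] [NormedSpace ℂ V]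
  [NormedAddCommGroup V'] [NormedSpace ℂ V']

/-- The closed span as a submodule. -/
def cs (S : Set V) : Submodule ℂ V := (Submodule.span ℂ S).topologicalClosure

lemma coe_cs (S : Set V) : (cs S : Set V) = cspan S := rfl

lemma mem_cs {S : Set V} {x : V} : x ∈ cs S ↔ x ∈ cspan S := Iff.rfl

lemma isClosed_cs (S : Set V) : IsClosed (cs S : Set V) :=
  Submodule.isClosed_topologicalClosure _

lemma subset_cs {S : Set V} {x : V} (hx : x ∈ S) : x ∈ cs S :=
  Submodule.le_topologicalClosure _ (Submodule.subset_span hx)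

lemma subset_cspan {S : Set V} {x : V} (hx : x ∈ S) : x ∈ cspan S := subset_cs hx

lemma map_mem {S : Set V} {M : Submodule ℂ V'} (hM : IsClosed (M : Set V'))
    (f : V →L[ℂ] V') (h : ∀ s ∈ S, f s ∈ M) {x : V} (hx : x ∈ cspan S) : f x ∈ M := by
  have h1 : Submodule.span ℂ S ≤ M.comap f.toLinearMap := Submodule.span_le.2 h
  have h2 : (Submodule.span ℂ S).topologicalClosure ≤ M.comap f.toLinearMap :=
    Submodule.topologicalClosure_minimal _ h1 (hM.preimage f.continuous)
  exact h2 hx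

end general

section compact

variable {H : Type*} [NormedAddCommGroup H] [InnerProductSpace ℂ H] [CompleteSpace H]

lemma rankOne_compact (p q : H) : IsCompactOperator (InnerProductSpace.rankOne ℂ p q) := by
  rw [InnerProductSpace.rankOne_def']
  exact IsCompactOperator.comp_clm (f := ContinuousLinearMap.toSpanSingleton ℂ p)
    (isCompactOperator_of_locallyCompactSpace_rng (ContinuousLinearMap.toSpanSingleton ℂ p))
    (innerSL ℂ q)

lemma compact_mem (k : H →L[ℂ] H) (hk : IsCompactOperator k) :
    k ∈ cspan {T : H →L[ℂ] H | ∃ p q, T = InnerProductSpace.rankOne ℂ p q} := by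
  refine Metric.mem_closure_iff.2 fun ε hε => ?_
  have hc := hk.isCompact_closure_image_closedBall (f := (k : H →ₗ[ℂ] H)) 1
  obtain ⟨t, htf, ht⟩ := Metric.totallyBounded_iff.1 hc.totallyBounded (ε / 2) (by positivity)
  let U : Submodule ℂ H := Submodule.span ℂ t
  have : FiniteDimensional ℂ U := FiniteDimensional.span_of_finite ℂ htf
  let b := stdOrthonormalBasis ℂ U
  refine ⟨U.starProjection ∘L k, ?_, ?_⟩
  · rw [b.starProjection_eq_sum_rankOne, ContinuousLinearMap.finsetSum_comp]
    refine Submodule.sum_mem _ fun i _ => Submodule.subset_span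
      ⟨(b i : H), ContinuousLinearMap.adjoint k (b i : H), ?_⟩
    ext x
    simp [ContinuousLinearMap.adjoint_inner_left]
  · rw [dist_eq_norm]
    refine lt_of_le_of_lt (ContinuousLinearMap.opNorm_le_of_unit_norm (C := ε / 2) (by positivity) ?_)
      (by linarith)
    intro x hx
    have hmem : k x ∈ closure ((k : H →ₗ[ℂ] H) '' Metric.closedBall 0 1) :=
      subset_closure ⟨x, by simp [hx], rfl⟩
    obtain ⟨y, hy, hyx⟩ := Set.mem_iUnion₂.1 (ht hmem)
    have := U.starProjection_minimal (k x)
    have h2 : ‖k x - U.starProjection (k x)‖ ≤ ‖k x - y‖ := by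
      rw [this]
      exact ciInf_le (f := fun w : U => ‖k x - (w : H)‖)
        ⟨0, by rintro _ ⟨w, rfl⟩; positivity⟩ ⟨y, Submodule.subset_span hy⟩
    rw [Metric.mem_ball, dist_eq_norm] at hyx
    exact h2.trans hyx.le

end compact

section tensor

variable {E F EF : Type*}
    [NormedAddCommGroup E] [InnerProductSpace ℂ E]
    [NormedAddCommGroup F] [InnerProductSpace ℂ F]
    [NormedAddCommGroup EF] [InnerProductSpace ℂ EF]
    {G : Type*} [NormedAddCommGroup G] [InnerProductSpace ℂ G]

lemma norm_lift (f : E →ₗ[ℂ] F →ₗ[ℂ] G) (C : ℝ) (hC : 0 ≤ C)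
    (hf : ∀ a b c d, ⟪f a b, f c d⟫_ℂ = (C : ℂ) ^ 2 * (⟪a, c⟫_ℂ * ⟪b, d⟫_ℂ)) (s : E ⊗[ℂ] F) :
    ‖TensorProduct.lift f s‖ = C * ‖s‖ := by
  have key : ∀ x y : E ⊗[ℂ] F, ⟪TensorProduct.lift f x, TensorProduct.lift f y⟫_ℂ
      = (C : ℂ) ^ 2 * ⟪x, y⟫_ℂ := by
    intro x y
    induction x using TensorProduct.induction_on with
    | zero => simp
    | add x1 x2 h1 h2 => simp [inner_add_left, h1, h2, mul_add]
    | tmul a b =>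
      induction y using TensorProduct.induction_on with
      | zero => simp
      | add x1 x2 h1 h2 => rw [map_add, inner_add_right, inner_add_right, h1, h2, mul_add]
      | tmul c d => simp [hf]
  have h := key s s
  rw [inner_self_eq_norm_sq_to_K, (inner_self_eq_norm_sq_to_K s : ⟪s, s⟫_ℂ = _), ← mul_pow] at h
  have h' : ‖TensorProduct.lift f s‖ ^ 2 = (C * ‖s‖) ^ 2 := by
    apply Complex.ofReal_injective
    push_cast
    exact h
  exact (pow_left_inj₀ (norm_nonneg _) (by positivity) two_ne_zero).1 h'

variable (t : TensorPair E F EF)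

lemma norm_e (s : E ⊗[ℂ] F) : ‖TensorProduct.lift t.tmul s‖ = ‖s‖ := by
  simpa using norm_lift t.tmul 1 zero_le_one (by simp [t.inner_tmul]) s

lemma dense_e : DenseRange (TensorProduct.lift t.tmul) := by
  refine t.dense_span.mono ?_
  have : Submodule.span ℂ {z : EF | ∃ a b, z = t.tmul a b}
      ≤ LinearMap.range (TensorProduct.lift t.tmul) := by
    refine Submodule.span_le.2 ?_
    rintro _ ⟨a, b, rfl⟩
    exact ⟨a ⊗ₜ b, by simp⟩
  exact this

lemma mem_cspan_tmul (z : EF) : z ∈ cspan {z : EF | ∃ a b, z = t.tmul a b} := t.dense_span z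

lemma clm_ext {G' : Type*} [NormedAddCommGroup G'] [NormedSpace ℂ G'] {S T : EF →L[ℂ] G'}
    (h : ∀ a b, S (t.tmul a b) = T (t.tmul a b)) : S = T := by
  refine ContinuousLinearMap.ext_on t.dense_span ?_
  rintro _ ⟨a, b, rfl⟩
  exact h a b

lemma vec_ext {x y : EF} (h : ∀ a b, ⟪t.tmul a b, x⟫_ℂ = ⟪t.tmul a b, y⟫_ℂ) : x = y := by
  have : innerSL ℂ x = innerSL ℂ y := clm_ext t fun a b => by
    have := congrArg (starRingEnd ℂ) (h a b)
    simpa [inner_conj_symm] using this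
  exact ext_inner_right ℂ fun z => by simpa using congrArg (fun f => f z) this

lemma inner_ext {K : Type*} [NormedAddCommGroup K] [InnerProductSpace ℂ K]
    (T : EF →L[ℂ] K) (w : K) (κ : ℂ) (v : EF)
    (h : ∀ a b, ⟪w, T (t.tmul a b)⟫_ℂ = ⟪v, t.tmul a b⟫_ℂ * κ) (z : EF) :
    ⟪w, T z⟫_ℂ = ⟪v, z⟫_ℂ * κ := by
  have : (innerSL ℂ w) ∘L T = κ • innerSL ℂ v := clm_ext t fun a b => by
    simp [h, mul_comm]
  have := congrArg (fun f => f z) this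
  simpa [mul_comm] using this

lemma norm_tmul (a : E) (b : F) : ‖t.tmul a b‖ = ‖a‖ * ‖b‖ := by
  have := norm_e t (a ⊗ₜ b)
  simpa using this

lemma exists_ext [CompleteSpace G] (f : E →ₗ[ℂ] F →ₗ[ℂ] G) (C : ℝ) (hC : 0 ≤ C)
    (hf : ∀ a b c d, ⟪f a b, f c d⟫_ℂ = (C : ℂ) ^ 2 * (⟪a, c⟫_ℂ * ⟪b, d⟫_ℂ)) :
    ∃ V : EF →L[ℂ] G, (∀ a b, V (t.tmul a b) = f a b) ∧ ∀ z, ‖V z‖ ≤ C * ‖z‖ := by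
  have hn : ∀ x, ‖TensorProduct.lift f x‖ ≤ C * ‖TensorProduct.lift t.tmul x‖ := fun x => by
    rw [norm_lift f C hC hf, norm_e]
  refine ⟨(TensorProduct.lift f).extendOfNorm (TensorProduct.lift t.tmul), fun a b => ?_,
    LinearMap.norm_extendOfNorm_apply_le (dense_e t) C hn⟩
  simpa using LinearMap.extendOfNorm_eq (dense_e t) ⟨C, hn⟩ (a ⊗ₜ b)

lemma exists_top [CompleteSpace EF] (a : E →L[ℂ] E) (b : F →L[ℂ] F) :
    ∃ T : EF →L[ℂ] EF, (∀ x y, T (t.tmul x y) = t.tmul (a x) (b y)) ∧ ‖T‖ ≤ ‖a‖ * ‖b‖ := by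
  let f : E ⊗[ℂ] F →ₗ[ℂ] EF := TensorProduct.lift t.tmul ∘ₗ (TensorProduct.map (a : E →ₗ[ℂ] E) (b : F →ₗ[ℂ] F))
  have hn : ∀ x, ‖f x‖ ≤ (‖a‖ * ‖b‖) * ‖TensorProduct.lift t.tmul x‖ := fun x => by
    rw [norm_e]
    simp only [f, LinearMap.comp_apply, norm_e]
    rw [← TensorProduct.mapL_apply]
    exact ((TensorProduct.mapL a b).le_opNorm x).trans
      (mul_le_mul_of_nonneg_right (TensorProduct.norm_mapL_le a b) (norm_nonneg _))
  refine ⟨f.extendOfNorm (TensorProduct.lift t.tmul), fun x y => ?_,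
    LinearMap.opNorm_extendOfNorm_le (dense_e t) (by positivity) hn⟩
  simpa [f] using LinearMap.extendOfNorm_eq (dense_e t) ⟨_, hn⟩ (x ⊗ₜ y)

lemma exists_L1 [CompleteSpace EF] :
    ∃ L : (E →L[ℂ] E) →L[ℂ] (EF →L[ℂ] EF), ∀ a x y, L a (t.tmul x y) = t.tmul (a x) y := by
  choose T hT hn using fun a : E →L[ℂ] E => exists_top t a (1 : F →L[ℂ] F)
  refine ⟨LinearMap.mkContinuous ⟨⟨T, fun a b => ?_⟩, fun c a => ?_⟩ 1 fun a => ?_,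
    fun a x y => by simp [hT]⟩
  · exact clm_ext t fun x y => by simp [hT]
  · exact clm_ext t fun x y => by simp [hT]
  · refine (hn a).trans ?_
    rw [one_mul]
    exact mul_le_of_le_one_right (norm_nonneg _) ContinuousLinearMap.norm_id_le

lemma exists_L2 [CompleteSpace EF] :
    ∃ L : (F →L[ℂ] F) →L[ℂ] (EF →L[ℂ] EF), ∀ a x y, L a (t.tmul x y) = t.tmul x (a y) := by
  choose T hT hn using fun a : F →L[ℂ] F => exists_top t (1 : E →L[ℂ] E) a
  refine ⟨LinearMap.mkContinuous ⟨⟨T, fun a b => ?_⟩, fun c a => ?_⟩ 1 fun a => ?_,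
    fun a x y => by simp [hT]⟩
  · exact clm_ext t fun x y => by simp [hT]
  · exact clm_ext t fun x y => by simp [hT]
  · refine (hn a).trans ?_
    exact mul_le_mul_of_nonneg_right ContinuousLinearMap.norm_id_le (norm_nonneg _)

lemma isTensorOp_unique {a : E →L[ℂ] E} {b : F →L[ℂ] F} {T T' : EF →L[ℂ] EF}
    (h : IsTensorOp t t a b T) (h' : IsTensorOp t t a b T') : T = T' :=
  clm_ext t fun x y => vec_ext t fun c d => by rw [h, h']

lemma isTensorOp_of {a : E →L[ℂ] E} {b : F →L[ℂ] F} {T : EF →L[ℂ] EF}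
    (h : ∀ x y, T (t.tmul x y) = t.tmul (a x) (b y)) : IsTensorOp t t a b T := by
  intro c d x y
  rw [h, t.inner_tmul]

/-- `x ↦ x ⊗ η`. -/
def R (η : F) : E →L[ℂ] EF :=
  (t.tmul.flip η).mkContinuous ‖η‖ fun x => by simp [norm_tmul, mul_comm]

lemma R_apply (η : F) (x : E) : R t η x = t.tmul x η := rfl

lemma adj_R [CompleteSpace E] [CompleteSpace EF] (η : F) (x : E) (y : F) :
    ContinuousLinearMap.adjoint (R t η) (t.tmul x y) = ⟪η, y⟫_ℂ • x := by
  refine ext_inner_left ℂ fun v => ?_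
  rw [ContinuousLinearMap.adjoint_inner_right, R_apply, t.inner_tmul, inner_smul_right, mul_comm]

end tensor

end RegMU

namespace RegMU

section triple

variable {H H2 H3 : Type*}
    [NormedAddCommGroup H] [InnerProductSpace ℂ H] [CompleteSpace H]
    [NormedAddCommGroup H2] [InnerProductSpace ℂ H2] [CompleteSpace H2]
    [NormedAddCommGroup H3] [InnerProductSpace ℂ H3] [CompleteSpace H3]

lemma vec_ext3 (t3 : TensorTriple H H H H3) {x y : H3}
    (h : ∀ a b c, ⟪t3.tmul a b c, x⟫_ℂ = ⟪t3.tmul a b c, y⟫_ℂ) : x = y := by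
  have : innerSL ℂ x = innerSL ℂ y := by
    refine ContinuousLinearMap.ext_on t3.dense_span ?_
    rintro _ ⟨a, b, c, rfl⟩
    have := congrArg (starRingEnd ℂ) (h a b c)
    simpa [inner_conj_symm] using this
  exact ext_inner_right ℂ fun z => by simpa using congrArg (fun f => f z) this

lemma exists_K (t2 : TensorPair H H H2) (t3 : TensorTriple H H H H3) :
    ∃ K : H →L[ℂ] H2 →L[ℂ] H3, ∀ x y z, K x (t2.tmul y z) = t3.tmul x y z := by
  have hx : ∀ x : H, ∃ V : H2 →L[ℂ] H3, (∀ a b, V (t2.tmul a b) = t3.tmul x a b) ∧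
      ∀ z, ‖V z‖ ≤ ‖x‖ * ‖z‖ := fun x => by
    refine exists_ext t2 (t3.tmul x) ‖x‖ (norm_nonneg _) fun a b c d => ?_
    rw [t3.inner_tmul, (inner_self_eq_norm_sq_to_K x : ⟪x, x⟫_ℂ = _), mul_assoc]
    rfl
  choose V hV hn using hx
  refine ⟨LinearMap.mkContinuous ⟨⟨V, fun a b => ?_⟩, fun c a => ?_⟩ 1 fun a => ?_,
    fun x y z => by simp [hV]⟩
  · exact clm_ext t2 fun x y => by simp [hV]
  · exact clm_ext t2 fun x y => by simp [hV]
  · rw [one_mul]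
    exact ContinuousLinearMap.opNorm_le_bound _ (norm_nonneg _) (hn a)

lemma exists_V (t2 : TensorPair H H H2) (t3 : TensorTriple H H H H3) (ξ : H) :
    ∃ V : H2 →L[ℂ] H3, ∀ x y, V (t2.tmul x y) = t3.tmul x ξ y := by
  obtain ⟨V, hV, -⟩ := exists_ext t2 (G := H3) (t3.tmul.flip ξ) ‖ξ‖ (norm_nonneg _)
    (fun a b c d => by
      rw [LinearMap.flip_apply, LinearMap.flip_apply, t3.inner_tmul,
        (inner_self_eq_norm_sq_to_K ξ : ⟪ξ, ξ⟫_ℂ = _), mul_comm ⟪a, c⟫_ℂ, mul_assoc]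
      rfl)
  exact ⟨V, hV⟩

lemma exists_Q (t2 : TensorPair H H H2) (t3 : TensorTriple H H H H3) (u : H) :
    ∃ V : H2 →L[ℂ] H3, ∀ x y, V (t2.tmul x y) = t3.tmul x y u := by
  let f : H →ₗ[ℂ] H →ₗ[ℂ] H3 := LinearMap.mk₂ ℂ (fun x y => t3.tmul x y u)
    (by simp) (by simp) (by simp) (by simp)
  obtain ⟨V, hV, -⟩ := exists_ext t2 (G := H3) f ‖u‖ (norm_nonneg _)
    (fun a b c d => by
      simp only [f, LinearMap.mk₂_apply]
      rw [t3.inner_tmul,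
        (inner_self_eq_norm_sq_to_K u : ⟪u, u⟫_ℂ = _), mul_comm]
      rfl)
  exact ⟨V, hV⟩

lemma exists_Phi (t2 : TensorPair H H H2) (t3 : TensorTriple H H H H3)
    (W : H2 →L[ℂ] H2) (W12 W23 W13 : H3 →L[ℂ] H3)
    (hW12 : IsLeg12 t2 t3 W W12) (hW23 : IsLeg23 t2 t3 W W23)
    (hW13 : IsLeg13 t2 t3 W W13)
    (hpent : W23 * W12 = W12 * W13 * W23)
    (Sg : H2 →L[ℂ] H2) (hSg : ∀ a b : H, Sg (t2.tmul a b) = t2.tmul b a)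
    (L1 L2 : (H →L[ℂ] H) →L[ℂ] (H2 →L[ℂ] H2))
    (hL1 : ∀ a x y, L1 a (t2.tmul x y) = t2.tmul (a x) y)
    (hL2 : ∀ a x y, L2 a (t2.tmul x y) = t2.tmul x (a y)) (ξ : H) :
    ∃ Φ : H2 →L[ℂ] (H →L[ℂ] H2),
      (∀ (η u : H) (z : H2) (a : H →L[ℂ] H), W z = t2.tmul η u →
        (∀ ζ ζ' : H, ⟪ζ, a ζ'⟫_ℂ = ⟪t2.tmul ζ ξ, W (t2.tmul ζ' η)⟫_ℂ) →
        Φ z = L1 a ∘L W ∘L R t2 u) ∧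
      (∀ (η u : H) (T : H →L[ℂ] H),
        (∀ ζ ζ' : H, ⟪ζ, T ζ'⟫_ℂ = ⟪t2.tmul ζ ξ, (Sg * W) (t2.tmul ζ' u)⟫_ℂ) →
        Φ (t2.tmul η u) = L2 T ∘L W ∘L R t2 η) := by
  obtain ⟨K, hK⟩ := exists_K t2 t3
  choose V hV using exists_V t2 t3
  choose Q hQ using exists_Q t2 t3
  have h12 : ∀ a b c, W12 (t3.tmul a b c) = Q c (W (t2.tmul a b)) := fun a b c =>
    vec_ext3 t3 fun a' b' c' => by
      rw [hW12, inner_ext t2 (Q c) (t3.tmul a' b' c') ⟪c', c⟫_ℂ (t2.tmul a' b')]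
      intro x y
      rw [hQ, t3.inner_tmul, t2.inner_tmul]
  have h13 : ∀ a b c, W13 (t3.tmul a b c) = V b (W (t2.tmul a c)) := fun a b c =>
    vec_ext3 t3 fun a' b' c' => by
      rw [hW13, inner_ext t2 (V b) (t3.tmul a' b' c') ⟪b', b⟫_ℂ (t2.tmul a' c')]
      intro x y
      rw [hV, t3.inner_tmul, t2.inner_tmul]
      ring
  have h23 : ∀ a z, W23 (K a z) = K a (W z) := fun a z => by
    have : W23 ∘L K a = K a ∘L W := clm_ext t2 fun b c => vec_ext3 t3 fun a' b' c' => by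
      simp only [ContinuousLinearMap.comp_apply]
      rw [hK, hW23, inner_ext t2 (K a) (t3.tmul a' b' c') ⟪a', a⟫_ℂ (t2.tmul b' c')]
      intro x y
      rw [hK, t3.inner_tmul, t2.inner_tmul]
      ring
    exact congrArg (fun f => f z) this
  have hSgi : ∀ d (z : H2), ⟪t2.tmul d ξ, Sg z⟫_ℂ = ⟪t2.tmul ξ d, z⟫_ℂ := fun d z => by
    have := inner_ext t2 Sg (t2.tmul d ξ) 1 (t2.tmul ξ d) (fun x y => by
      rw [hSg, t2.inner_tmul, t2.inner_tmul]; ring) z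
    simpa using this
  let B : H3 →L[ℂ] H2 := ContinuousLinearMap.adjoint (V ξ) ∘L W23 ∘L W12
  refine ⟨(ContinuousLinearMap.compL ℂ H H3 H2 B) ∘L K.flip, ?_, ?_⟩
  · intro η u z a hz ha
    have hL : ContinuousLinearMap.adjoint (V ξ) ∘L W12 ∘L V η = L1 a := by
      refine isTensorOp_unique t2 (a := a) (b := 1) ?_ (isTensorOp_of t2 (by simp [hL1]))
      intro y d x c
      simp only [ContinuousLinearMap.comp_apply, ContinuousLinearMap.adjoint_inner_right]
      rw [hV, hV, hW12, ha]
      rfl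
    ext x
    have hp : W23 (W12 (K x z)) = W12 (W13 (W23 (K x z))) :=
      congrArg (fun f => f (K x z)) hpent
    have e : W23 (W12 (K x z)) = W12 (V η (W (t2.tmul x u))) := by
      rw [hp, h23, hz, hK, h13]
    rw [← hL]
    simp only [B, ContinuousLinearMap.comp_apply, ContinuousLinearMap.compL_apply,
      ContinuousLinearMap.flip_apply, R_apply, e]
  · intro η u T hT
    have hL : ContinuousLinearMap.adjoint (V ξ) ∘L W23 ∘L Q u = L2 T := by
      refine isTensorOp_unique t2 (a := 1) (b := T) ?_ (isTensorOp_of t2 (by simp [hL2]))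
      intro y d x c
      simp only [ContinuousLinearMap.comp_apply, ContinuousLinearMap.adjoint_inner_right]
      rw [hV, hQ, hW23, hT, ← hSgi, mul_comm]
      rfl
    ext x
    rw [← hL]
    simp only [B, ContinuousLinearMap.comp_apply, ContinuousLinearMap.compL_apply,
      ContinuousLinearMap.flip_apply, R_apply, hK, h12]

end triple

end RegMU

/-- For a regular multiplicative unitary `W` on `H`,
`[(a ⊗ 1)·W·(1 ⊗ k) : a ∈ Â(W), k ∈ K(H)] = Â(W) ⊗min K(H)`. -/
theorem statement7
    {H H2 H3 : Type*}
    [NormedAddCommGroup H] [InnerProductSpace ℂ H] [CompleteSpace H]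
    [NormedAddCommGroup H2] [InnerProductSpace ℂ H2] [CompleteSpace H2]
    [NormedAddCommGroup H3] [InnerProductSpace ℂ H3] [CompleteSpace H3]
    -- realizations of the tensor products H ⊗ H and H ⊗ H ⊗ H
    (t2 : TensorPair H H H2) (t3 : TensorTriple H H H H3)
    -- W is a unitary on H ⊗ H
    (W : H2 →L[ℂ] H2) (hWu : star W * W = 1 ∧ W * star W = 1)
    -- the legs W₁₂, W₂₃, W₁₃ of W on H ⊗ H ⊗ H
    (W12 W23 W13 : H3 →L[ℂ] H3)
    (hW12 : IsLeg12 t2 t3 W W12) (hW23 : IsLeg23 t2 t3 W W23)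
    (hW13 : IsLeg13 t2 t3 W W13)
    -- the pentagon equation W₂₃W₁₂ = W₁₂W₁₃W₂₃
    (hpent : W23 * W12 = W12 * W13 * W23)
    -- the tensor flip Σ on H ⊗ H
    (Sg : H2 →L[ℂ] H2) (hSg : ∀ a b : H, Sg (t2.tmul a b) = t2.tmul b a)
    -- regularity: C(W) = K(H)
    (hreg : hatA t2 (Sg * W) = {T : H →L[ℂ] H | IsCompactOperator T}) :
    cspan {y : H2 →L[ℂ] H2 | ∃ a ∈ hatA t2 W, ∃ k : H →L[ℂ] H, IsCompactOperator k ∧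
        ∃ Ta Tk : H2 →L[ℂ] H2, IsTensorOp t2 t2 a 1 Ta ∧ IsTensorOp t2 t2 1 k Tk ∧
          y = Ta * W * Tk}
      = minTensor t2 (hatA t2 W) {T : H →L[ℂ] H | IsCompactOperator T} := by
  obtain ⟨L1, hL1⟩ := RegMU.exists_L1 t2
  obtain ⟨L2, hL2⟩ := RegMU.exists_L2 t2
  choose Φ hΦ1 hΦ2 using RegMU.exists_Phi t2 t3 W W12 W23 W13 hW12 hW23 hW13 hpent Sg hSg
    L1 L2 hL1 hL2
  have op1 : ∀ a, IsTensorOp t2 t2 a 1 (L1 a) := fun a => RegMU.isTensorOp_of t2 (by simp [hL1])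
  have op2 : ∀ k, IsTensorOp t2 t2 1 k (L2 k) := fun a => RegMU.isTensorOp_of t2 (by simp [hL2])
  have op12 : ∀ a k, IsTensorOp t2 t2 a k (L1 a * L2 k) := fun a k =>
    RegMU.isTensorOp_of t2 (by simp [hL1, hL2])
  have hWW : ∀ z, W (star W z) = z := fun z => congrArg (fun f => f z) hWu.2
  have hWW' : ∀ z, star W (W z) = z := fun z => congrArg (fun f => f z) hWu.1
  -- `R η R β* = 1 ⊗ |η⟩⟨β|`
  have hRR : ∀ η β, RegMU.R t2 η ∘L ContinuousLinearMap.adjoint (RegMU.R t2 β)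
      = L2 (InnerProductSpace.rankOne ℂ η β) := fun η β => RegMU.clm_ext t2 fun x y => by
    simp [RegMU.adj_R, RegMU.R_apply, hL2]
  -- slices exist
  let sl : H → H → (H →L[ℂ] H) := fun ξ η =>
    ContinuousLinearMap.adjoint (RegMU.R t2 ξ) ∘L W ∘L RegMU.R t2 η
  have hsl : ∀ ξ η (ζ ζ' : H), ⟪ζ, sl ξ η ζ'⟫_ℂ = ⟪t2.tmul ζ ξ, W (t2.tmul ζ' η)⟫_ℂ := by
    intro ξ η ζ ζ'
    simp [sl, ContinuousLinearMap.adjoint_inner_right, RegMU.R_apply]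
  have hslu : ∀ (a : H →L[ℂ] H) ξ η, (∀ ζ ζ' : H, ⟪ζ, a ζ'⟫_ℂ
      = ⟪t2.tmul ζ ξ, W (t2.tmul ζ' η)⟫_ℂ) → a = sl ξ η := fun a ξ η h => by
    ext x
    exact ext_inner_left ℂ fun v => by rw [h, hsl]
  have hslA : ∀ ξ η, sl ξ η ∈ hatA t2 W := fun ξ η => RegMU.subset_cspan ⟨ξ, η, hsl ξ η⟩
  -- `(1 ⊗ |p⟩⟨q|) W R η R β* = sl q η ⊗ |p⟩⟨β|`
  have hA : ∀ p q η β, L2 (InnerProductSpace.rankOne ℂ p q) * W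
      * L2 (InnerProductSpace.rankOne ℂ η β)
      = L1 (sl q η) * L2 (InnerProductSpace.rankOne ℂ p β) := fun p q η β => by
    refine RegMU.clm_ext t2 fun x y => ?_
    rw [← hRR p q]
    simp [hL1, hL2, sl, RegMU.R_apply]
  have hB1 : ∀ ξ η u β (z : H2), W z = t2.tmul η u →
      Φ ξ z ∘L ContinuousLinearMap.adjoint (RegMU.R t2 β)
      = L1 (sl ξ η) * W * L2 (InnerProductSpace.rankOne ℂ u β) := fun ξ η u β z hz => by
    rw [hΦ1 ξ η u z _ hz (hsl ξ η), ← hRR]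
    rfl
  have hB2 : ∀ ξ η u β (T : H →L[ℂ] H), (∀ ζ ζ' : H, ⟪ζ, T ζ'⟫_ℂ
      = ⟪t2.tmul ζ ξ, (Sg * W) (t2.tmul ζ' u)⟫_ℂ) →
      Φ ξ (t2.tmul η u) ∘L ContinuousLinearMap.adjoint (RegMU.R t2 β)
      = L2 T * W * L2 (InnerProductSpace.rankOne ℂ η β) := fun ξ η u β T hT => by
    rw [hΦ2 ξ η u _ hT, ← hRR]
    rfl
  let P : H → (H →L[ℂ] H2) →L[ℂ] (H2 →L[ℂ] H2) := fun β =>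
    (ContinuousLinearMap.compL ℂ H2 H H2).flip (ContinuousLinearMap.adjoint (RegMU.R t2 β))
  let mulL : (H2 →L[ℂ] H2) → (H2 →L[ℂ] H2) →L[ℂ] (H2 →L[ℂ] H2) := fun X =>
    ContinuousLinearMap.mul ℂ (H2 →L[ℂ] H2) X
  let mulR : (H2 →L[ℂ] H2) → (H2 →L[ℂ] H2) →L[ℂ] (H2 →L[ℂ] H2) := fun X =>
    (ContinuousLinearMap.mul ℂ (H2 →L[ℂ] H2)).flip X
  -- the slice of `ΣW` exists
  let sl' : H → H → (H →L[ℂ] H) := fun ξ u =>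
    ContinuousLinearMap.adjoint (RegMU.R t2 ξ) ∘L (Sg * W) ∘L RegMU.R t2 u
  have hsl' : ∀ ξ η (ζ ζ' : H), ⟪ζ, sl' ξ η ζ'⟫_ℂ
      = ⟪t2.tmul ζ ξ, (Sg * W) (t2.tmul ζ' η)⟫_ℂ := by
    intro ξ η ζ ζ'
    simp [sl', ContinuousLinearMap.adjoint_inner_right, RegMU.R_apply]
  apply Set.Subset.antisymm
  · -- `⊆`
    intro y hy
    set M := RegMU.cs {T : H2 →L[ℂ] H2 | ∃ a ∈ hatA t2 W,
      ∃ b ∈ {T : H →L[ℂ] H | IsCompactOperator T}, IsTensorOp t2 t2 a b T} with hMdef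
    have hM : IsClosed (M : Set (H2 →L[ℂ] H2)) := RegMU.isClosed_cs _
    change y ∈ M
    refine RegMU.map_mem hM (ContinuousLinearMap.id ℂ _) ?_ hy
    rintro _ ⟨a, ha, k, hk, Ta, Tk, hTa, hTk, rfl⟩
    rw [RegMU.isTensorOp_unique t2 hTa (op1 a), RegMU.isTensorOp_unique t2 hTk (op2 k)]
    change (mulR (L2 k) ∘L mulR W ∘L L1) a ∈ M
    refine RegMU.map_mem hM _ ?_ ha
    rintro a ⟨ξ, η, ha'⟩
    obtain rfl := hslu a ξ η ha'
    change (mulL (L1 (sl ξ η) * W) ∘L L2) k ∈ M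
    refine RegMU.map_mem hM _ ?_ (RegMU.compact_mem k hk)
    rintro _ ⟨u, β, rfl⟩
    change L1 (sl ξ η) * W * L2 (InnerProductSpace.rankOne ℂ u β) ∈ M
    rw [← hB1 ξ η u β (star W (t2.tmul η u)) (hWW _)]
    change (P β ∘L Φ ξ) (star W (t2.tmul η u)) ∈ M
    refine RegMU.map_mem hM _ ?_ (RegMU.mem_cspan_tmul t2 _)
    rintro _ ⟨η, u, rfl⟩
    change Φ ξ (t2.tmul η u) ∘L ContinuousLinearMap.adjoint (RegMU.R t2 β) ∈ M
    rw [hB2 ξ η u β (sl' ξ u) (hsl' ξ u)]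
    have hc : IsCompactOperator (sl' ξ u) := by
      have : sl' ξ u ∈ hatA t2 (Sg * W) := RegMU.subset_cspan ⟨ξ, u, hsl' ξ u⟩
      rw [hreg] at this
      exact this
    change (mulR (L2 (InnerProductSpace.rankOne ℂ η β)) ∘L mulR W ∘L L2) (sl' ξ u) ∈ M
    refine RegMU.map_mem hM _ ?_ (RegMU.compact_mem _ hc)
    rintro _ ⟨p, q, rfl⟩
    change L2 (InnerProductSpace.rankOne ℂ p q) * W * L2 (InnerProductSpace.rankOne ℂ η β) ∈ M
    rw [hA]
    exact RegMU.subset_cs ⟨_, hslA q η, _, RegMU.rankOne_compact p β, op12 _ _⟩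
  · -- `⊇`
    intro y hy
    set M := RegMU.cs {y : H2 →L[ℂ] H2 | ∃ a ∈ hatA t2 W, ∃ k : H →L[ℂ] H,
        IsCompactOperator k ∧
        ∃ Ta Tk : H2 →L[ℂ] H2, IsTensorOp t2 t2 a 1 Ta ∧ IsTensorOp t2 t2 1 k Tk ∧
          y = Ta * W * Tk} with hMdef
    have hM : IsClosed (M : Set (H2 →L[ℂ] H2)) := RegMU.isClosed_cs _
    change y ∈ M
    refine RegMU.map_mem hM (ContinuousLinearMap.id ℂ _) ?_ hy
    rintro T ⟨a, ha, k, hk, hT⟩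
    rw [RegMU.isTensorOp_unique t2 hT (op12 a k)]
    change (mulR (L2 k) ∘L L1) a ∈ M
    refine RegMU.map_mem hM _ ?_ ha
    rintro a ⟨q, η, ha'⟩
    obtain rfl := hslu a q η ha'
    change (mulL (L1 (sl q η)) ∘L L2) k ∈ M
    refine RegMU.map_mem hM _ ?_ (RegMU.compact_mem k hk)
    rintro _ ⟨p, β, rfl⟩
    change L1 (sl q η) * L2 (InnerProductSpace.rankOne ℂ p β) ∈ M
    rw [← hA]
    have hc : InnerProductSpace.rankOne ℂ p q ∈ hatA t2 (Sg * W) := by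
      rw [hreg]
      exact RegMU.rankOne_compact p q
    change (mulR (L2 (InnerProductSpace.rankOne ℂ η β)) ∘L mulR W ∘L L2)
      (InnerProductSpace.rankOne ℂ p q) ∈ M
    refine RegMU.map_mem hM _ ?_ hc
    rintro T ⟨ξ, u, hT⟩
    change L2 T * W * L2 (InnerProductSpace.rankOne ℂ η β) ∈ M
    rw [← hB2 ξ η u β T hT, ← hWW' (t2.tmul η u)]
    change (P β ∘L Φ ξ ∘L star W) (W (t2.tmul η u)) ∈ M
    refine RegMU.map_mem hM _ ?_ (RegMU.mem_cspan_tmul t2 _)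
    rintro _ ⟨η, u, rfl⟩
    change Φ ξ (star W (t2.tmul η u)) ∘L ContinuousLinearMap.adjoint (RegMU.R t2 β) ∈ M
    rw [hB1 ξ η u β _ (hWW _)]
    exact RegMU.subset_cs ⟨_, hslA ξ η, _, RegMU.rankOne_compact u β, _, _, op1 _, op2 _, rfl⟩

end
end
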